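/- (Lemma for H.) Given D, k, r ≥ 1 and ξ, β > 0 with ξ ≤ 1/(kr) and β ≤ 10^{−10}ξ²/(Dk⁴r), the following holds. Let H be a D-degenerate graph on n vertices, L a labelling of its vertex set of bandwidth at most βn, and σ: V(H) → {0,…,k} a proper (k+1)-colouring that is (10/ξ, β)-zero-free with respect to L, where colour zero does not appear among the first √β·n vertices of L. Let R^k_r be a graph on [r]×[k] with K^k_r ⊆ B^k_r ⊆ R^k_r such that for every i ∈ [r] there exists a vertex z_i ∈ ([r]∖{i})×[k] adjacent in R^k_r to (i,j) for every j ∈ [k]. Then, given a k-equitable integer partition {m_{i,j}}_{i∈[r],j∈[k]} of n with n/(10kr) ≤ m_{i,j} ≤ 10n/(kr) for all i, j, there exist a mapping f: V(H) → [r]×[k] and a set X ⊆ V(H) such that for every i ∈ [r] and j ∈ [k]: (H1) m_{i,j} − ξn ≤ |f^{−1}(i,j)| ≤ m_{i,j} + ξn; (H2) |X| ≤ ξn; (H3) {f(x), f(y)} ∈ E(R^k_r) for every edge {x,y} ∈ E(H); (H4) for every x ∈ f^{−1}(i,j)∖X and edges xy, yz ∈ E(H), both y and z lie in ∪_{j'∈[k]}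 f^{−1}(i,j'); (H5) f(x) = (1, σ(x)) for every x among the first √β·n vertices of L; (H6) the number of x ∈ f^{−1}(i,j) with deg_H(x) ≤ 2D is at least |f^{−1}(i,j)|/(24D). -/

import Mathlib

open Filter

noncomputable section

/-- Number of ordered pairs `(x, y)` with `x ∈ X`, `y ∈ Y` adjacent in `G`;
for disjoint `X`, `Y` this is the number of edges of `G` between `X` and `Y`. -/
def eXY {n : ℕ} (G : SimpleGraph (Fin n)) (X Y : Finset (Fin n)) : ℕ :=
  Nat.card {q : Fin n × Fin n // q.1 ∈ X ∧ q.2 ∈ Y ∧ G.Adj q.1 q.2}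

/-- Number of edges of `G` inside `X`. -/
def eIn {n : ℕ} (G : SimpleGraph (Fin n)) (X : Finset (Fin n)) : ℕ := eXY G X X / 2

/-- The neighbourhood of `v` in `G` restricted to `U`. -/
def nbhdIn {n : ℕ} (G : SimpleGraph (Fin n)) (v : Fin n) (U : Finset (Fin n)) :
    Finset (Fin n) :=
  @Finset.filter _ (fun u => G.Adj v u) (fun _ => Classical.propDecidable _) U

/-- Common neighbourhood of `{w j : j ∈ Λ}` in `G`, restricted to `U`. -/
def commonNbhd {n s : ℕ} (G : SimpleGraph (Fin n)) (w : Fin s → Fin n)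
    (Λ : Finset (Fin s)) (U : Finset (Fin n)) : Finset (Fin n) :=
  @Finset.filter _ (fun u => ∀ j ∈ Λ, G.Adj (w j) u) (fun _ => Classical.propDecidable _) U

/-- The degree of `v` in `G`. -/
def degV {V : Type*} (G : SimpleGraph V) (v : V) : ℕ := Nat.card (G.neighborSet v)

/-- The minimum degree of `G` is at least `x`. -/
def MinDegGe {V : Type*} (G : SimpleGraph V) (x : ℝ) : Prop := ∀ v, x ≤ (degV G v : ℝ)

/-- The maximum degree of `G` is at most `D`. -/
def MaxDegLe {V : Type*} (G : SimpleGraph V) (D : ℕ) : Prop := ∀ v, degV G v ≤ D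

/-- `H` has a labelling of its `n` vertices by `1, …, n` in which the endpoints of
every edge are at distance at most `b`. -/
def HasBandwidthLe {n : ℕ} (H : SimpleGraph (Fin n)) (b : ℝ) : Prop :=
  ∃ L : Equiv.Perm (Fin n), ∀ u v, H.Adj u v → |((L u : ℕ) : ℝ) - ((L v : ℕ) : ℝ)| ≤ b

/-- `v` lies in a triangle of `H`. -/
def InTriangle {n : ℕ} (H : SimpleGraph (Fin n)) (v : Fin n) : Prop :=
  ∃ u w, H.Adj v u ∧ H.Adj v w ∧ H.Adj u w

/-- `v` lies in a four-cycle of `H`. -/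
def InC4 {n : ℕ} (H : SimpleGraph (Fin n)) (v : Fin n) : Prop :=
  ∃ a b c, v ≠ b ∧ a ≠ c ∧ H.Adj v a ∧ H.Adj a b ∧ H.Adj b c ∧ H.Adj c v

/-- `H` has degeneracy at most `D`: every (induced) subgraph has a vertex of degree
at most `D`. -/
def DegeneracyLe {n : ℕ} (H : SimpleGraph (Fin n)) (D : ℕ) : Prop :=
  ∀ A : Finset (Fin n), A.Nonempty → ∃ v ∈ A, (nbhdIn H v A).card ≤ D

/-- `G` contains a copy of `H`. -/
def ContainsCopy {n m : ℕ} (G : SimpleGraph (Fin n)) (H : SimpleGraph (Fin m)) : Prop :=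
  ∃ f : Fin m → Fin n, Function.Injective f ∧ ∀ u v, H.Adj u v → G.Adj (f u) (f v)

open Classical in
/-- The probability that the binomial random graph `G(n,p)` has the property `Q`. -/
def gnpProb (n : ℕ) (p : ℝ) (Q : SimpleGraph (Fin n) → Prop) : ℝ :=
  ∑ G : SimpleGraph (Fin n),
    if Q G then p ^ Nat.card G.edgeSet * (1 - p) ^ (n.choose 2 - Nat.card G.edgeSet) else 0

/-- The property `Q` holds asymptotically almost surely in `G(n, p n)`. -/
def AAS (p : ℕ → ℝ) (Q : (n : ℕ) → SimpleGraph (Fin n) → Prop) : Prop :=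
  Tendsto (fun n => gnpProb n (p n) (Q n)) atTop (nhds 1)

/-- `Γ` is `(p,ν)`-bijumbled. -/
def Bijumbled {n : ℕ} (Γ : SimpleGraph (Fin n)) (p ν : ℝ) : Prop :=
  ∀ X Y : Finset (Fin n), Disjoint X Y →
    |(eXY Γ X Y : ℝ) - p * X.card * Y.card| ≤ ν * Real.sqrt ((X.card : ℝ) * Y.card)

/-- `(X,Y)` is an `(ε,d,p)`-lower-regular pair in `G`. -/
def LowerReg {n : ℕ} (G : SimpleGraph (Fin n)) (ε d p : ℝ) (X Y : Finset (Fin n)) : Prop :=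
  ∀ X' ⊆ X, ∀ Y' ⊆ Y, ε * X.card ≤ X'.card → ε * Y.card ≤ Y'.card →
    d - ε ≤ (eXY G X' Y' : ℝ) / (p * X'.card * Y'.card)

/-- `(X,Y)` is an `(ε,d,p)`-regular pair in `G`. -/
def Reg {n : ℕ} (G : SimpleGraph (Fin n)) (ε d p : ℝ) (X Y : Finset (Fin n)) : Prop :=
  ∃ d', d ≤ d' ∧ ∀ X' ⊆ X, ∀ Y' ⊆ Y, ε * X.card ≤ X'.card → ε * Y.card ≤ Y'.card →
    |(eXY G X' Y' : ℝ) / (p * X'.card * Y'.card) - d'| ≤ ε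

/-- The degree conditions of `(ε,d,p)`-super-regularity of the pair `(X,Y)` for
`G ⊆ Γ`. -/
def SuperDeg {n : ℕ} (Γ G : SimpleGraph (Fin n)) (ε d p : ℝ) (X Y : Finset (Fin n)) : Prop :=
  (∀ x ∈ X, (d - ε) * max (p * Y.card) (((nbhdIn Γ x Y).card : ℝ) / 2)
      ≤ ((nbhdIn G x Y).card : ℝ)) ∧
  (∀ y ∈ Y, (d - ε) * max (p * X.card) (((nbhdIn Γ y X).card : ℝ) / 2)
      ≤ ((nbhdIn G y X).card : ℝ))

/-- The backbone graph `B^k_r` on `[r] × [k]`: `(i,j)` and `(i',j')` are adjacent iff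
`|i - i'| ≤ 1` and `j ≠ j'`. -/
def Bgraph (r k : ℕ) : SimpleGraph (Fin r × Fin k) :=
  SimpleGraph.fromRel fun a b =>
    ((a.1 : ℕ) ≤ (b.1 : ℕ) + 1 ∧ (b.1 : ℕ) ≤ (a.1 : ℕ) + 1) ∧ a.2 ≠ b.2

/-- The clique factor `K^k_r` on `[r] × [k]`: `(i,j)` and `(i',j')` are adjacent iff
`i = i'` and `j ≠ j'`. -/
def Kgraph (r k : ℕ) : SimpleGraph (Fin r × Fin k) :=
  SimpleGraph.fromRel fun a b => a.1 = b.1 ∧ a.2 ≠ b.2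

/-- `P` is a `k`-equitable partition of `U` indexed by `[r] × [k]`. -/
def IsEquitablePartitionOn {n r k : ℕ} (P : Fin r → Fin k → Finset (Fin n))
    (U : Finset (Fin n)) : Prop :=
  (∀ a b : Fin r × Fin k, a ≠ b → Disjoint (P a.1 a.2) (P b.1 b.2)) ∧
  (Finset.univ.biUnion (fun a : Fin r × Fin k => P a.1 a.2) = U) ∧
  (∀ i : Fin r, ∀ j j' : Fin k, ((P i j).card : ℤ) - ((P i j').card : ℤ) ≤ 1)

/-- Block `t` (for `t ≥ 1`) of the labelling `L`, i.e. the vertices with labels in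
`((t-1)·4kβn, t·4kβn]`, contains a vertex of colour zero. -/
def BlockHasZero {n k : ℕ} (β : ℝ) (L : Equiv.Perm (Fin n)) (σ : Fin n → Fin (k+1))
    (t : ℕ) : Prop :=
  ∃ v, σ v = 0 ∧ ((t : ℝ) - 1) * (4 * k * β * n) < ((L v : ℕ) : ℝ) + 1 ∧
    ((L v : ℕ) : ℝ) + 1 ≤ (t : ℝ) * (4 * k * β * n)

/-- The colouring `σ` is `(z, β)`-zero-free with respect to the labelling `L`: any two
blocks containing colour zero are at least `z` apart. -/
def ZeroFree {n k : ℕ} (z β : ℝ) (L : Equiv.Perm (Fin n)) (σ : Fin n → Fin (k+1)) : Prop :=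
  ∀ t₁ t₂ : ℕ, 1 ≤ t₁ → t₁ < t₂ → BlockHasZero β L σ t₁ → BlockHasZero β L σ t₂ →
    z ≤ (t₂ : ℝ) - (t₁ : ℝ)

end

lemma rounding {S T ι : Type} [Fintype S] [Fintype T] [Fintype ι] [Nonempty T] [Nonempty S]
    (x : S → T → ι → ℝ) (B : ι → ℝ) (h0 : ∀ s t i, 0 ≤ x s t i)
    (hB : ∀ s t i, x s t i ≤ B i) :
    ∃ τ : S → T, ∀ i, |(∑ s, x s (τ s) i) - ∑ s, (∑ t, x s t i) / (Fintype.card T : ℝ)|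
      ≤ (Fintype.card ι : ℝ) * B i := by
  classical
  set target : ι → ℝ := fun i => ∑ s, (∑ t, x s t i) / (Fintype.card T : ℝ) with htarget
  let Good : (S → T → ℝ) → Prop := fun w => (∀ s t, 0 ≤ w s t) ∧ (∀ s, ∑ t, w s t = 1) ∧
    ∀ i, ∑ s, ∑ t, w s t * x s t i = target i
  let supp : (S → T → ℝ) → Finset (S × T) := fun w => Finset.univ.filter (fun p => w p.1 p.2 ≠ 0)
  have hcT : (0 : ℝ) < Fintype.card T := by exact_mod_cast Fintype.card_pos
  have hex : ∃ m : ℕ, ∃ w, Good w ∧ (supp w).card = m := by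
    refine ⟨_, fun _ _ => 1 / (Fintype.card T : ℝ), ⟨fun _ _ => by positivity, ?_, ?_⟩, rfl⟩
    · intro s
      simp [Finset.sum_const, Finset.card_univ]
    · intro i
      simp only [htarget]
      refine Finset.sum_congr rfl fun s _ => ?_
      rw [Finset.sum_div]
      refine Finset.sum_congr rfl fun t _ => ?_
      ring
  obtain ⟨w, hw, hwm⟩ := Nat.find_spec hex
  have hmin : ∀ w', Good w' → (supp w).card ≤ (supp w').card := by
    intro w' hw'
    rw [hwm]
    exact Nat.find_min' hex ⟨w', hw', rfl⟩
  obtain ⟨hw0, hw1, hwx⟩ := hw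
  let F : Finset S := Finset.univ.filter (fun s => ∃ t t', t ≠ t' ∧ w s t ≠ 0 ∧ w s t' ≠ 0)
  have hF : F.card ≤ Fintype.card ι := by
    by_contra hlt
    push Not at hlt
    have hFs : ∀ s : F, ∃ t t', t ≠ t' ∧ w s t ≠ 0 ∧ w s t' ≠ 0 := fun s => by
      have := s.2
      simp only [F, Finset.mem_filter, Finset.mem_univ, true_and] at this
      exact this
    choose p p' hpp hp hp' using hFs
    let uvec : F → (ι → ℝ) := fun s i => x s (p s) i - x s (p' s) i
    have hnl : ¬ LinearIndependent ℝ uvec := by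
      intro hl
      have := hl.fintype_card_le_finrank
      rw [Module.finrank_fintype_fun_eq_card] at this
      simp at this
      omega
    rw [Fintype.not_linearIndependent_iff] at hnl
    obtain ⟨g, hg, s0, hs0⟩ := hnl
    let d : S → T → ℝ := fun s t => if h : s ∈ F then
      g ⟨s, h⟩ * ((if t = p ⟨s, h⟩ then 1 else 0) - (if t = p' ⟨s, h⟩ then 1 else 0)) else 0
    have hd1 : ∀ s, ∑ t, d s t = 0 := by
      intro s
      by_cases h : s ∈ F
      · simp only [d, h, dif_pos, ← Finset.mul_sum, Finset.sum_sub_distrib]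
        simp
      · simp [d, h]
    have hdx : ∀ i, ∑ s, ∑ t, d s t * x s t i = 0 := by
      intro i
      have h1 : ∀ s, ∑ t, d s t * x s t i
          = if h : s ∈ F then g ⟨s, h⟩ * uvec ⟨s, h⟩ i else 0 := by
        intro s
        by_cases h : s ∈ F
        · simp only [d, h, dif_pos, uvec]
          simp only [mul_assoc, ← Finset.mul_sum, sub_mul, Finset.sum_sub_distrib]
          simp
        · simp [d, h]
      simp only [h1]
      have h2 := congrFun hg i
      simp only [Finset.sum_apply, Pi.smul_apply, smul_eq_mul, Pi.zero_apply] at h2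
      refine Eq.trans ?_ h2
      rw [← Finset.sum_subset (Finset.subset_univ F)]
      · rw [← Finset.sum_coe_sort F]
        refine Finset.sum_congr rfl fun s _ => ?_
        simp
      · intro s _ hs
        simp [hs]
    have hdsupp : ∀ s t, d s t ≠ 0 → w s t ≠ 0 := by
      intro s t hne
      by_cases h : s ∈ F
      · simp only [d, h, dif_pos] at hne
        by_cases h1 : t = p ⟨s, h⟩
        · rw [h1]; exact hp ⟨s, h⟩
        · by_cases h2 : t = p' ⟨s, h⟩
          · rw [h2]; exact hp' ⟨s, h⟩
          · simp [h1, h2] at hne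
      · simp [d, h] at hne
    have hneg : ∃ q : S × T, d q.1 q.2 < 0 := by
      rcases lt_or_gt_of_ne hs0 with h | h
      · refine ⟨(s0, p s0), ?_⟩
        have := hpp s0
        simp [d, this, h]
      · refine ⟨(s0, p' s0), ?_⟩
        have := (hpp s0).symm
        simp [d, this, h]
    let NG : Finset (S × T) := Finset.univ.filter (fun q => d q.1 q.2 < 0)
    have hNG : NG.Nonempty := by
      obtain ⟨q, hq⟩ := hneg
      exact ⟨q, by simp [NG, hq]⟩
    obtain ⟨q, hq, hqmin⟩ := Finset.exists_min_image NG (fun q => w q.1 q.2 / (-d q.1 q.2)) hNG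
    have hqd : d q.1 q.2 < 0 := by simpa [NG] using hq
    set θ := w q.1 q.2 / (-d q.1 q.2) with hθ
    have hθ0 : 0 ≤ θ := div_nonneg (hw0 _ _) (by linarith)
    have hgood : Good (fun s t => w s t + θ * d s t) := by
      refine ⟨?_, ?_, ?_⟩
      · intro s t
        by_cases hn : d s t < 0
        · have := hqmin (s, t) (by simp [NG, hn])
          simp only at this
          rw [le_div_iff₀ (by linarith)] at this
          linarith
        · push Not at hn
          have := hw0 s t
          have := mul_nonneg hθ0 hn
          simp only
          linarith
      · intro s
        rw [Finset.sum_add_distrib, ← Finset.mul_sum, hd1, hw1]; ring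
      · intro i
        simp only [add_mul, Finset.sum_add_distrib, mul_assoc, ← Finset.mul_sum, hdx, hwx]
        ring
    have hlt2 : (supp (fun s t => w s t + θ * d s t)).card < (supp w).card := by
      apply Finset.card_lt_card
      rw [Finset.ssubset_iff_of_subset]
      · refine ⟨q, ?_, ?_⟩
        · simp only [supp, Finset.mem_filter, Finset.mem_univ, true_and]
          exact hdsupp _ _ hqd.ne
        · simp only [supp, Finset.mem_filter, Finset.mem_univ, true_and, not_not]
          rw [hθ]
          have : d q.1 q.2 ≠ 0 := hqd.ne
          field_simp
          ring
      · intro a ha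
        simp only [supp, Finset.mem_filter, Finset.mem_univ, true_and] at ha ⊢
        intro h0
        apply ha
        by_cases hda : d a.1 a.2 = 0
        · rw [h0, hda]; ring
        · exact absurd h0 (hdsupp _ _ hda)
    have := hmin _ hgood
    omega
  have hτ : ∀ s, ∃ t, w s t ≠ 0 := by
    intro s
    by_contra hh
    push Not at hh
    have := hw1 s
    simp [hh] at this
  choose τ hτ using hτ
  refine ⟨τ, fun i => ?_⟩
  change |_ - target i| ≤ _
  rw [← hwx i, ← Finset.sum_sub_distrib]
  have hterm : ∀ s, |x s (τ s) i - ∑ t, w s t * x s t i| ≤ if s ∈ F then B i else 0 := by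
    intro s
    by_cases h : s ∈ F
    · rw [if_pos h]
      have h1 : 0 ≤ ∑ t, w s t * x s t i :=
        Finset.sum_nonneg fun t _ => mul_nonneg (hw0 _ _) (h0 _ _ _)
      have h2 : ∑ t, w s t * x s t i ≤ B i := by
        calc ∑ t, w s t * x s t i ≤ ∑ t, w s t * B i :=
              Finset.sum_le_sum fun t _ => mul_le_mul_of_nonneg_left (hB _ _ _) (hw0 _ _)
          _ = B i := by rw [← Finset.sum_mul, hw1, one_mul]
      have := h0 s (τ s) i
      have := hB s (τ s) i
      rw [abs_le]; constructor <;> linarith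
    · rw [if_neg h]
      have hz : ∀ t, t ≠ τ s → w s t = 0 := by
        intro t ht
        by_contra hne
        apply h
        simp only [F, Finset.mem_filter, Finset.mem_univ, true_and]
        exact ⟨t, τ s, ht, hne, hτ s⟩
      have h1 : w s (τ s) = 1 := by
        rw [← hw1 s]
        exact (Finset.sum_eq_single _ (fun t _ ht => hz t ht) (by simp)).symm
      have h2 : ∑ t, w s t * x s t i = x s (τ s) i := by
        rw [Finset.sum_eq_single (τ s) (fun t _ ht => by rw [hz t ht, zero_mul]) (by simp), h1,
          one_mul]
      rw [h2]; simp
  obtain ⟨s⟩ := ‹Nonempty S›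
  obtain ⟨t⟩ := ‹Nonempty T›
  have hBi : 0 ≤ B i := (h0 s t i).trans (hB s t i)
  calc |∑ s, (x s (τ s) i - ∑ t, w s t * x s t i)|
      ≤ ∑ s, |x s (τ s) i - ∑ t, w s t * x s t i| := Finset.abs_sum_le_sum_abs _ _
    _ ≤ ∑ s, (if s ∈ F then B i else 0) := Finset.sum_le_sum fun s _ => hterm s
    _ = F.card * B i := by rw [Finset.sum_ite_mem]; simp
    _ ≤ _ := mul_le_mul_of_nonneg_right (by exact_mod_cast hF) hBi

lemma degen_sum {n : ℕ} (H : SimpleGraph (Fin n)) (D : ℕ) (hH : DegeneracyLe H D) :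
    ∀ (m : ℕ) (A : Finset (Fin n)), A.card = m →
      ∑ v ∈ A, (nbhdIn H v A).card ≤ 2 * D * A.card := by
  classical
  intro m
  induction m with
  | zero =>
    intro A hA
    rw [Finset.card_eq_zero] at hA
    simp [hA]
  | succ m ih =>
    intro A hA
    obtain ⟨v, hv, hd⟩ := hH A (Finset.card_pos.mp (by omega))
    have hc : (A.erase v).card = m := by rw [Finset.card_erase_of_mem hv]; omega
    have h1 := ih (A.erase v) hc
    have h2 : ∀ x ∈ A.erase v, (nbhdIn H x A).card
        = (nbhdIn H x (A.erase v)).card + if H.Adj v x then 1 else 0 := by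
      intro x hx
      unfold nbhdIn
      rw [Finset.filter_erase]
      by_cases hvx : H.Adj v x
      · rw [if_pos hvx, Finset.card_erase_add_one]
        simp [hv, hvx.symm]
      · rw [if_neg hvx, Finset.erase_eq_of_notMem]
        · rfl
        · simp [hv]
          exact fun h => hvx h.symm
    have h3 : ∑ x ∈ A.erase v, (if H.Adj v x then 1 else 0) ≤ D := by
      refine le_trans ?_ hd
      rw [← Finset.sum_filter, Finset.sum_const, smul_eq_mul, mul_one]
      apply Finset.card_le_card
      intro x hx
      simp only [Finset.mem_filter, Finset.mem_erase, nbhdIn] at hx ⊢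
      exact ⟨hx.1.2, hx.2⟩
    rw [← Finset.add_sum_erase A _ hv, Finset.sum_congr rfl h2, Finset.sum_add_distrib]
    rw [hc] at h1
    rw [hA]
    have : 2 * D * (m + 1) = 2 * D * m + 2 * D := by ring
    omega

lemma low_count {n : ℕ} (H : SimpleGraph (Fin n)) (D : ℕ) (hH : DegeneracyLe H D)
    (A A' : Finset (Fin n)) (hAA : A ⊆ A') (hN : ∀ v ∈ A, ∀ u, H.Adj v u → u ∈ A') :
    (2 * D + 1) * A.card ≤ (2 * D + 1) * (A.filter (fun v => degV H v ≤ 2 * D)).card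
      + 2 * D * A'.card := by
  classical
  have h1 := degen_sum H D hH _ A' rfl
  have h2 : ∑ v ∈ A, degV H v ≤ ∑ v ∈ A', (nbhdIn H v A').card := by
    refine le_trans (Finset.sum_le_sum (f := fun v => degV H v) fun v hv => ?_)
      (Finset.sum_le_sum_of_subset hAA)
    unfold degV
    rw [Nat.card_eq_fintype_card, ← Set.toFinset_card]
    apply Finset.card_le_card
    intro u hu
    simp only [Set.mem_toFinset, SimpleGraph.mem_neighborSet] at hu
    simp only [nbhdIn, Finset.mem_filter]
    exact ⟨hN v hv u hu, hu⟩
  have h3 : (2 * D + 1) * (A.filter (fun v => ¬ degV H v ≤ 2 * D)).card ≤ ∑ v ∈ A, degV H v := by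
    rw [mul_comm, ← smul_eq_mul]
    refine le_trans (Finset.card_nsmul_le_sum _ (fun v => degV H v) _ ?_)
      (Finset.sum_le_sum_of_subset (Finset.filter_subset _ A))
    intro v hv
    simp only [Finset.mem_filter] at hv
    omega
  have h4 := Finset.card_filter_add_card_filter_not (s := A) (fun v => degV H v ≤ 2 * D)
  rw [← h4, mul_add]
  omega

lemma hole1 {α : Type} [DecidableEq α] (f : α → α) (hf : ∀ x y, f x = f y → x = y) (b c c' : α)
    (h : c ≠ c') : some (f c) ≠ (if c' = b then none else some (f c')) := by
  intro hh; split_ifs at hh; exact h (hf _ _ (by simpa using hh))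

lemma hole1i {α : Type} [DecidableEq α] (f : α → α) (hf : ∀ x y, f x = f y → x = y) (b c c' : α)
    (hh : (if c = b then none else some (f c)) = (if c' = b then none else some (f c'))) :
    c = c' := by
  grind

lemma hole2 {α : Type} [DecidableEq α] (f : α → α) (hf : ∀ x y, f x = f y → x = y)
    (a b c c' : α) (hab : a ≠ b) (h : c ≠ c') : (if c = b then none else some (f c)) ≠
      (if c' = b then none else if c' = a then some (f b) else some (f c')) := by
  grind

lemma hole2i {α : Type} [DecidableEq α] (f : α → α) (hf : ∀ x y, f x = f y → x = y)
    (a b c c' : α) (hab : a ≠ b)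
    (hh : (if c = b then none else if c = a then some (f b) else some (f c)) =
      (if c' = b then none else if c' = a then some (f b) else some (f c'))) : c = c' := by
  grind

lemma hole3 {α : Type} [DecidableEq α] (f : α → α) (hf : ∀ x y, f x = f y → x = y)
    (a b c c' : α) (hab : a ≠ b) (h : c ≠ c') :
    (if c = b then none else if c = a then some (f b) else some (f c)) ≠
      some (if c' = b then f a else if c' = a then f b else f c') := by
  grind

lemma walk_aux {k : ℕ} (π π' : Equiv.Perm (Fin k)) : ∀ j ≤ k,
    ∃ (ω : ℕ → Fin k → Option (Fin k)) (ρ : Equiv.Perm (Fin k)),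
      (∀ c : Fin k, (c : ℕ) < j → ρ c = π' c) ∧
      (∀ c, ω 0 c = some (π c)) ∧ (∀ m, 3 * j ≤ m → ∀ c, ω m c = some (ρ c)) ∧
      (∀ m, Function.Injective (ω m)) ∧ (∀ m c c', c ≠ c' → ω m c ≠ ω (m + 1) c') := by
  intro j
  induction j with
  | zero =>
    intro _
    refine ⟨fun _ c => some (π c), π, by simp, by simp, by simp, ?_, ?_⟩
    · intro m a b h; simpa using h
    · intro m c c' h h'
      exact h (by simpa using h')
  | succ j ih =>
    intro hj
    obtain ⟨ω, ρ, h1, h2, h3, h4, h5⟩ := ih (by omega)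
    let a : Fin k := ⟨j, by omega⟩
    by_cases ha : ρ a = π' a
    · refine ⟨ω, ρ, ?_, h2, fun m hm => h3 m (by omega), h4, h5⟩
      intro c hc
      rcases Nat.lt_succ_iff_lt_or_eq.mp hc with h | h
      · exact h1 c h
      · have : c = a := Fin.ext h
        rw [this, ha]
    · let b : Fin k := ρ.symm (π' a)
      have hb : ρ b = π' a := by simp [b]
      have hab : a ≠ b := by
        intro h; rw [← h] at hb; exact ha hb
      have hbj : ¬ (b : ℕ) < j := by
        intro h
        have := h1 b h
        rw [hb] at this
        exact hab (π'.injective this)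
      let ω' : ℕ → Fin k → Option (Fin k) := fun m c =>
        if m ≤ 3 * j then ω m c
        else if m = 3 * j + 1 then (if c = b then none else some (ρ c))
        else if m = 3 * j + 2 then (if c = b then none else if c = a then some (ρ b) else some (ρ c))
        else some ((Equiv.swap a b).trans ρ c)
      have e0 : ∀ c, ω' (3 * j) c = some (ρ c) := by
        intro c
        simp only [ω', le_refl, if_true]
        exact h3 _ le_rfl c
      have e1 : ∀ c, ω' (3 * j + 1) c = (if c = b then none else some (ρ c)) := by
        intro c; simp [ω']
      have e2 : ∀ c, ω' (3 * j + 2) c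
          = (if c = b then none else if c = a then some (ρ b) else some (ρ c)) := by
        intro c; simp [ω']
      have e3 : ∀ m, 3 * j + 3 ≤ m → ∀ c, ω' m c = some ((Equiv.swap a b).trans ρ c) := by
        intro m hm c
        simp only [ω']
        rw [if_neg (by omega), if_neg (by omega), if_neg (by omega)]
      have e3' : ∀ c, (Equiv.swap a b).trans ρ c
          = if c = b then ρ a else if c = a then ρ b else ρ c := by
        intro c
        simp only [Equiv.trans_apply, Equiv.swap_apply_def]
        grind
      refine ⟨ω', (Equiv.swap a b).trans ρ, ?_, ?_, ?_, ?_, ?_⟩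
      · intro c hc
        rcases Nat.lt_succ_iff_lt_or_eq.mp hc with h | h
        · have hca : c ≠ a := by
            intro h'; rw [h'] at h; simp [a] at h
          have hcb : c ≠ b := by
            intro h'; rw [h'] at h; exact hbj h
          rw [e3', if_neg hcb, if_neg hca]
          exact h1 c h
        · have : c = a := Fin.ext h
          rw [this, e3', if_neg hab, if_pos rfl, hb]
      · intro c
        simp [ω', h2]
      · intro m hm c
        exact e3 m (by omega) c
      · intro m
        rcases lt_trichotomy m (3 * j + 1) with h | h | h
        · have : ω' m = ω m := by
            funext c; simp only [ω']; rw [if_pos (by omega)]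
          rw [this]; exact h4 m
        · intro c c' hh
          rw [h, e1, e1] at hh
          exact hole1i ρ (fun _ _ h => ρ.injective h) b c c' hh
        · rcases Nat.lt_or_ge (3 * j + 2) m with h' | h'
          · intro c c' hh
            rw [e3 m (by omega), e3 m (by omega)] at hh
            exact ((Equiv.swap a b).trans ρ).injective (by simpa using hh)
          · have : m = 3 * j + 2 := by omega
            intro c c' hh
            rw [this, e2, e2] at hh
            exact hole2i ρ (fun _ _ h => ρ.injective h) a b c c' hab hh
      · intro m c c' hcc
        rcases lt_trichotomy m (3 * j) with h | h | h
        · have ha1 : ω' m = ω m := by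
            funext c; simp only [ω']; rw [if_pos (by omega)]
          have ha2 : ω' (m + 1) = ω (m + 1) := by
            funext c; simp only [ω']; rw [if_pos (by omega)]
          rw [ha1, ha2]; exact h5 m c c' hcc
        · rw [h, e0, e1]
          exact hole1 ρ (fun _ _ h => ρ.injective h) b c c' hcc
        · rcases Nat.lt_or_ge m (3 * j + 2) with h' | h'
          · have hm : m = 3 * j + 1 := by omega
            rw [hm, e1, e2]
            exact hole2 ρ (fun _ _ h => ρ.injective h) a b c c' hab hcc
          · rcases Nat.lt_or_ge m (3 * j + 3) with h'' | h''
            · have hm : m = 3 * j + 2 := by omega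
              rw [hm, e2, e3 _ (by omega), e3']
              exact hole3 ρ (fun _ _ h => ρ.injective h) a b c c' hab hcc
            · rw [e3 m (by omega), e3 (m + 1) (by omega)]
              intro hh
              exact hcc (((Equiv.swap a b).trans ρ).injective (by simpa using hh))

lemma walk {k : ℕ} (π π' : Equiv.Perm (Fin k)) :
    ∃ (ω : ℕ → Fin k → Option (Fin k)),
      (∀ c, ω 0 c = some (π c)) ∧ (∀ m, 3 * k ≤ m → ∀ c, ω m c = some (π' c)) ∧
      (∀ m, Function.Injective (ω m)) ∧ (∀ m c c', c ≠ c' → ω m c ≠ ω (m + 1) c') := by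
  obtain ⟨ω, ρ, h1, h2, h3, h4, h5⟩ := walk_aux π π' k le_rfl
  refine ⟨ω, h2, fun m hm c => ?_, h4, h5⟩
  rw [h3 m hm c, h1 c c.2]

/-- number of labels in a half-open real interval -/
lemma label_le {n : ℕ} (L : Equiv.Perm (Fin n)) (α γ : ℝ) (h : α ≤ γ) (A : Finset (Fin n))
    (hA : ∀ v ∈ A, α < ((L v : ℕ) : ℝ) + 1 ∧ ((L v : ℕ) : ℝ) + 1 ≤ γ) :
    (A.card : ℝ) ≤ γ - α + 1 := by
  have hinj : Set.InjOn (fun v : Fin n => (((L v : ℕ) : ℤ) + 1)) A := by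
    intro a _ b _ hab
    simp only at hab
    apply L.injective
    apply Fin.ext
    omega
  rw [← Finset.card_image_of_injOn hinj]
  have hsub : A.image (fun v : Fin n => (((L v : ℕ) : ℤ) + 1)) ⊆ Finset.Ioc ⌊α⌋ ⌊γ⌋ := by
    intro x hx
    obtain ⟨v, hv, rfl⟩ := Finset.mem_image.mp hx
    have := hA v hv
    rw [Finset.mem_Ioc, Int.floor_lt, Int.le_floor]
    push_cast
    exact this
  have h1 := Finset.card_le_card hsub
  rw [Int.card_Ioc] at h1
  have h2 : ((⌊γ⌋ - ⌊α⌋).toNat : ℝ) = ⌊γ⌋ - ⌊α⌋ := by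
    have : (((⌊γ⌋ - ⌊α⌋).toNat : ℤ) : ℝ) = ((⌊γ⌋ - ⌊α⌋ : ℤ) : ℝ) := by
      rw [Int.toNat_of_nonneg]
      have := Int.floor_le_floor h
      omega
    push_cast at this
    exact this
  have h3 : ((A.image (fun v : Fin n => (((L v : ℕ) : ℤ) + 1))).card : ℝ) ≤
    ((⌊γ⌋ - ⌊α⌋).toNat : ℝ) := by exact_mod_cast h1
  rw [h2] at h3
  have := Int.floor_le γ
  have := Int.lt_floor_add_one α
  linarith

lemma label_ge {n : ℕ} (L : Equiv.Perm (Fin n)) (α γ : ℝ) (h0 : 0 ≤ α) (hn : γ ≤ n)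
    (A : Finset (Fin n))
    (hA : ∀ v, α < ((L v : ℕ) : ℝ) + 1 → ((L v : ℕ) : ℝ) + 1 ≤ γ → v ∈ A) :
    γ - α - 1 ≤ (A.card : ℝ) := by
  rcases lt_or_ge γ α with h | h
  · have : (0 : ℝ) ≤ A.card := by positivity
    linarith
  have h1 : Finset.Ioc ⌊α⌋₊ ⌊γ⌋₊ ⊆ A.image (fun v : Fin n => ((L v : ℕ) + 1)) := by
    intro x hx
    rw [Finset.mem_Ioc] at hx
    have hx1 := (Nat.floor_lt h0).mp hx.1
    have hx2 := (Nat.le_floor_iff (h0.trans h)).mp hx.2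
    have hxn : x ≤ n := by exact_mod_cast hx2.trans hn
    have hx0 : 1 ≤ x := by omega
    rw [Finset.mem_image]
    refine ⟨L.symm ⟨x - 1, by omega⟩, ?_, ?_⟩
    · apply hA
      · simp only [Equiv.apply_symm_apply]
        rw [Nat.cast_sub hx0]; push_cast; linarith
      · simp only [Equiv.apply_symm_apply]
        rw [Nat.cast_sub hx0]; push_cast; linarith
    · simp only [Equiv.apply_symm_apply]; omega
  have h2 := (Finset.card_le_card h1).trans Finset.card_image_le
  rw [Nat.card_Ioc] at h2
  have h3 : ⌊α⌋₊ ≤ ⌊γ⌋₊ := Nat.floor_le_floor h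
  have h4 : (⌊γ⌋₊ : ℝ) - ⌊α⌋₊ ≤ A.card := by
    have : ⌊γ⌋₊ ≤ A.card + ⌊α⌋₊ := by omega
    have : (⌊γ⌋₊ : ℝ) ≤ A.card + ⌊α⌋₊ := by exact_mod_cast this
    linarith
  have := Nat.floor_le h0
  have := Nat.lt_floor_add_one γ
  linarith

/-- spaced sets of naturals are small -/
lemma spaced_card (Z : Finset ℕ) (s M : ℝ) (hs : 0 < s) (hM : 0 ≤ M)
    (hZ : ∀ a ∈ Z, ∀ b ∈ Z, a < b → s ≤ (b : ℝ) - a) (hb : ∀ a ∈ Z, (a : ℝ) ≤ M) :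
    (Z.card : ℝ) ≤ 1 + M / s := by
  have key : ∀ m : ℕ, ∀ Z : Finset ℕ, Z.card = m + 1 →
      (∀ a ∈ Z, ∀ b ∈ Z, a < b → s ≤ (b : ℝ) - a) →
      ∃ a ∈ Z, (m : ℝ) * s ≤ a ∧ ∀ b ∈ Z, b ≤ a := by
    intro m
    induction m with
    | zero =>
      intro Z hc _
      have hne : Z.Nonempty := Finset.card_pos.mp (by omega)
      refine ⟨Z.max' hne, Z.max'_mem hne, by simp, fun b hb => Z.le_max' b hb⟩
    | succ m ih =>
      intro Z hc hZ
      have hne : Z.Nonempty := Finset.card_pos.mp (by omega)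
      obtain ⟨a, ha, h1, h2⟩ := ih (Z.erase (Z.max' hne))
        (by rw [Finset.card_erase_of_mem (Z.max'_mem hne)]; omega)
        (fun a ha b hb => hZ a (Finset.mem_of_mem_erase ha) b (Finset.mem_of_mem_erase hb))
      refine ⟨Z.max' hne, Z.max'_mem hne, ?_, fun b hb => Z.le_max' b hb⟩
      have hlt : a < Z.max' hne :=
        lt_of_le_of_ne (Z.le_max' a (Finset.mem_of_mem_erase ha)) (Finset.ne_of_mem_erase ha)
      have := hZ a (Finset.mem_of_mem_erase ha) _ (Z.max'_mem hne) hlt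
      push_cast
      linarith
  rcases Nat.eq_zero_or_pos Z.card with h | h
  · rw [h]; simp; positivity
  · obtain ⟨m, hm⟩ : ∃ m, Z.card = m + 1 := ⟨Z.card - 1, by omega⟩
    obtain ⟨a, ha, h1, _⟩ := key m Z hm hZ
    have := hb a ha
    rw [hm]
    push_cast
    have : (m : ℝ) ≤ M / s := by rw [le_div_iff₀ hs]; linarith
    linarith


lemma exact_fill {n r k : ℕ} (m : Fin r → Fin k → ℕ) (hm : (∑ i, ∑ j, m i j) = n)
    (P : Finset (Fin n)) (g : Fin n → Fin r × Fin k)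
    (hP : ∀ a : Fin r × Fin k, (P.filter (fun v => g v = a)).card ≤ m a.1 a.2) :
    ∃ f : Fin n → Fin r × Fin k, (∀ v ∈ P, f v = g v) ∧
      ∀ i j, (Finset.univ.filter (fun v => f v = (i, j))).card = m i j := by
  classical
  let p : Fin r × Fin k → ℕ := fun a => (P.filter (fun v => g v = a)).card
  have hp : ∑ a, p a = P.card := (Finset.card_eq_sum_card_fiberwise (fun _ _ => Finset.mem_univ _)).symm
  have hm' : ∑ a : Fin r × Fin k, m a.1 a.2 = n := by
    rw [← hm, ← Finset.univ_product_univ, Finset.sum_product]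
  have hcard : Fintype.card {v // v ∉ P} = Fintype.card (Σ a : Fin r × Fin k, Fin (m a.1 a.2 - p a)) := by
    rw [Fintype.card_sigma, Fintype.card_subtype_compl]
    simp only [Fintype.card_fin, Fintype.card_coe]
    have : ∑ a : Fin r × Fin k, (m a.1 a.2 - p a) + ∑ a, p a = n := by
      rw [← Finset.sum_add_distrib, ← hm']
      exact Finset.sum_congr rfl fun a _ => Nat.sub_add_cancel (hP a)
    omega
  let e := Fintype.equivOfCardEq hcard
  let f : Fin n → Fin r × Fin k := fun v => if h : v ∈ P then g v else (e ⟨v, h⟩).1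
  refine ⟨f, fun v hv => by simp [f, hv], fun i j => ?_⟩
  have h1 : Finset.univ.filter (fun v => f v = (i, j))
      = P.filter (fun v => g v = (i, j)) ∪
        (Finset.univ.filter (fun y : {v // v ∉ P} => (e y).1 = (i, j))).map
          (Function.Embedding.subtype _) := by
    ext v
    by_cases hv : v ∈ P <;> simp [f, hv]
  have h2 : (Finset.univ.filter (fun y : {v // v ∉ P} => (e y).1 = (i, j))).card
      = m i j - p (i, j) := by
    have : (Finset.univ.filter (fun y : {v // v ∉ P} => (e y).1 = (i, j)))
      = (Finset.univ : Finset (Fin (m i j - p (i, j)))).map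
        ⟨fun t => e.symm ⟨(i, j), t⟩, fun a b h => by simpa using h⟩ := by
      ext y
      simp only [Finset.mem_filter, Finset.mem_univ, true_and, Finset.mem_map]
      constructor
      · intro h
        rcases hy : e y with ⟨a, t⟩
        rw [hy] at h
        simp only at h
        subst h
        exact ⟨t, (e.symm_apply_eq.mpr hy.symm :)⟩
      · rintro ⟨t, rfl⟩
        exact (congrArg Sigma.fst (e.apply_symm_apply ⟨(i, j), t⟩) :)
    rw [this]; simp
  rw [h1, Finset.card_union_of_disjoint, Finset.card_map, h2]
  · have := hP (i, j)
    simp only [p] at this ⊢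
    omega
  · rw [Finset.disjoint_left]
    intro v hv hv'
    simp only [Finset.mem_filter] at hv
    simp only [Finset.mem_map, Function.Embedding.subtype_apply] at hv'
    obtain ⟨y, _, rfl⟩ := hv'
    exact y.2 hv.1

lemma sections_exist (ZB : ℕ → Prop) (hZ : ∀ a b, a < b → ZB a → ZB b → a + 10 ≤ b)
    (T1 l : ℕ) :
    ∃ E : ℕ → ℕ, E 0 = 0 ∧ (∀ q, T1 + q * l ≤ E (q + 1) ∧ E (q + 1) ≤ T1 + q * l + 3) ∧
      ∀ q b, b ≤ E (q + 1) + 1 → E (q + 1) ≤ b + 1 → ¬ ZB b := by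
  have h : ∀ q, ∃ e, (T1 + q * l ≤ e ∧ e ≤ T1 + q * l + 3) ∧
      ∀ b, b ≤ e + 1 → e ≤ b + 1 → ¬ ZB b := by
    intro q
    by_cases hh : ∀ b, b ≤ (T1 + q * l) + 1 → (T1 + q * l) ≤ b + 1 → ¬ ZB b
    · exact ⟨T1 + q * l, ⟨le_rfl, by omega⟩, hh⟩
    · push Not at hh
      obtain ⟨b, h1, h2, h3⟩ := hh
      refine ⟨T1 + q * l + 3, ⟨by omega, le_rfl⟩, ?_⟩
      intro b' h1' h2' h3'
      have := hZ b b' (by omega) h3 h3'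
      omega
  choose e he1 he2 using h
  exact ⟨fun q => if q = 0 then 0 else e (q - 1), by simp, fun q => by simpa using he1 q,
    fun q => by simpa using he2 q⟩

lemma sec_exist (E : ℕ → ℕ) (h0 : E 0 = 0) (hE : StrictMono E) :
    ∃ sec : ℕ → ℕ, ∀ b, E (sec b) ≤ b ∧ b < E (sec b + 1) := by
  have : ∀ b, ∃ q, E q ≤ b ∧ b < E (q + 1) := by
    intro b
    refine ⟨Nat.findGreatest (fun q => E q ≤ b) b, ?_, ?_⟩
    · exact Nat.findGreatest_spec (P := fun q => E q ≤ b) (Nat.zero_le b) (by simp [h0])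
    · by_contra hh
      push Not at hh
      have := Nat.le_findGreatest (P := fun q => E q ≤ b) (n := b) ((hE.le_apply).trans hh) hh
      omega
  choose s hs using this
  exact ⟨s, hs⟩

lemma idx_exist (r : ℕ) (hr : 1 ≤ r) (S : ℕ → ℝ) (l : ℝ) (hl : 0 < l) (hS0 : S 0 = 0)
    (hS : ∀ i, i < r → S i + l ≤ S (i + 1)) :
    ∃ idx : ℕ → ℕ, idx 0 = 0 ∧ (∀ q, idx (q + 1) = idx q ∨ idx (q + 1) = idx q + 1) ∧
      (∀ q, idx q < r) ∧ (∀ q, S (idx q) ≤ q * l) ∧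
      (∀ q, idx q + 1 < r → q * l < S (idx q + 1)) := by
  classical
  let idx : ℕ → ℕ := fun q => Nat.rec 0 (fun q p =>
    if p + 1 < r ∧ S (p + 1) ≤ ((q + 1 : ℕ) : ℝ) * l then p + 1 else p) q
  have hs : ∀ q, idx (q + 1) = if idx q + 1 < r ∧ S (idx q + 1) ≤ ((q + 1 : ℕ) : ℝ) * l
      then idx q + 1 else idx q := fun q => rfl
  have hlt : ∀ q, idx q < r := by
    intro q
    induction q with
    | zero => exact hr
    | succ q ih => rw [hs]; split_ifs with h; exacts [h.1, ih]
  refine ⟨idx, rfl, fun q => ?_, hlt, fun q => ?_, fun q => ?_⟩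
  · rw [hs]; split_ifs <;> simp
  · induction q with
    | zero => change S 0 ≤ _; rw [hS0]; simp
    | succ q ih =>
      rw [hs]; split_ifs with h
      · exact h.2
      · push_cast; linarith
  · induction q with
    | zero =>
      intro _
      change _ < S (0 + 1)
      have := hS 0 hr
      rw [hS0] at this
      simp only [zero_add] at this ⊢
      push_cast; linarith
    | succ q ih =>
      rw [hs]; split_ifs with h
      · intro h2
        have h3 := ih h.1
        have := hS (idx q + 1) h.1
        push_cast; linarith
      · intro h2
        have h4 : ¬ (S (idx q + 1) ≤ ((q + 1 : ℕ) : ℝ) * l) := fun h5 => h ⟨h2, h5⟩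
        push Not at h4
        exact h4


def finPr {k : ℕ} (hk : 1 ≤ k) (c : Fin (k + 1)) : Fin k := ⟨(c : ℕ) - 1, by omega⟩

lemma finPr_inj {k : ℕ} (hk : 1 ≤ k) (c c' : Fin (k + 1)) (h : c ≠ 0) (h' : c' ≠ 0)
    (hh : finPr hk c = finPr hk c') : c = c' := by
  have h1 : (c : ℕ) ≠ 0 := fun e => h (Fin.ext e)
  have h2 : (c' : ℕ) ≠ 0 := fun e => h' (Fin.ext e)
  simp only [finPr, Fin.mk.injEq] at hh
  apply Fin.ext
  omega

def kap {k : ℕ} (hk : 1 ≤ k) (cc : Fin (k + 1)) (π : Equiv.Perm (Fin k)) (c : Fin (k + 1)) :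
    Option (Fin k) :=
  if c = cc then none else if c = 0 then some (π (finPr hk cc)) else some (π (finPr hk c))

lemma kap_ne {k : ℕ} (hk : 1 ≤ k) (cc cc' : Fin (k + 1)) (π : Equiv.Perm (Fin k))
    (c c' : Fin (k + 1)) (h : c ≠ c')
    (hcc : cc = cc' ∨ (c ≠ 0 ∧ c' ≠ 0 ∧ (cc = 0 ∨ cc' = 0))) :
    kap hk cc π c ≠ kap hk cc' π c' := by
  have key : ∀ x y : Fin (k + 1), x ≠ 0 → y ≠ 0 → π (finPr hk x) = π (finPr hk y) → x = y :=
    fun x y hx hy hxy => finPr_inj hk x y hx hy (π.injective hxy)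
  unfold kap
  grind

lemma kap_zero {k : ℕ} (hk : 1 ≤ k) (π : Equiv.Perm (Fin k)) (c : Fin (k + 1)) (h : c ≠ 0) :
    kap hk 0 π c = some (π (finPr hk c)) := by
  simp [kap, h]

lemma kap_map {k : ℕ} (hk : 1 ≤ k) (cc : Fin (k + 1)) (π : Equiv.Perm (Fin k))
    (c : Fin (k + 1)) : kap hk cc π c = (kap hk cc (Equiv.refl _) c).map π := by
  unfold kap
  split_ifs <;> simp

def Wset (Zf : ℕ → Prop) (u : ℕ) : Prop := Zf (u - 1) ∨ Zf u ∨ Zf (u + 1)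

open Classical in
noncomputable def ccol {k : ℕ} (Zf : ℕ → Prop) (cq : ℕ → Fin (k + 1)) (q u : ℕ) : Fin (k + 1) :=
  if Wset Zf u then cq q else 0

open Classical in
noncomputable def stt {k : ℕ} (hk : 1 ≤ k) (Zf : ℕ → Prop) (E sec : ℕ → ℕ)
    (cq : ℕ → Fin (k + 1)) (π : ℕ → Equiv.Perm (Fin k))
    (ω : ℕ → ℕ → Fin k → Option (Fin k)) (u : ℕ) (c : Fin (k + 1)) : Option (Fin k) :=
  if 1 ≤ sec (u / (4 * k)) ∧ u / (4 * k) = E (sec (u / (4 * k))) then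
    (if c = 0 then none else ω (sec (u / (4 * k)) - 1) (u % (4 * k)) (finPr hk c))
  else kap hk (ccol Zf cq (sec (u / (4 * k))) u) (π (sec (u / (4 * k)))) c

lemma divK {K b u : ℕ} (h1 : K * b ≤ u) (h2 : u < K * b + K) : u / K = b := by
  have hK : 0 < K := by
    rcases Nat.eq_zero_or_pos K with h | h
    · subst h; omega
    · exact h
  apply le_antisymm
  · have : u < K * (b + 1) := by rw [mul_add, mul_one]; exact h2
    exact Nat.lt_succ_iff.mp (Nat.div_lt_of_lt_mul this)
  · rw [Nat.le_div_iff_mul_le hK, mul_comm]; exact h1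

lemma div_step {K u v : ℕ} (hK : 0 < K) (h1 : u ≤ v + K) : u / K ≤ v / K + 1 := by
  have := Nat.div_le_div_right (c := K) h1
  rwa [Nat.add_div_right _ hK] at this

lemma sec_unique (E sec : ℕ → ℕ) (hE : StrictMono E)
    (hsec : ∀ b, E (sec b) ≤ b ∧ b < E (sec b + 1)) (b q : ℕ) (h1 : E q ≤ b)
    (h2 : b < E (q + 1)) : sec b = q := by
  have a := (hE.lt_iff_lt).mp (lt_of_le_of_lt h1 (hsec b).2)
  have c := (hE.lt_iff_lt).mp (lt_of_le_of_lt (hsec b).1 h2)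
  omega

lemma stt_same {k : ℕ} (hk : 1 ≤ k) (Zf : ℕ → Prop) (E sec : ℕ → ℕ)
    (cq : ℕ → Fin (k + 1)) (π : ℕ → Equiv.Perm (Fin k))
    (ω : ℕ → ℕ → Fin k → Option (Fin k))
    (hfree : ∀ q u, u / (4 * k) ≤ E (q + 1) + 1 → E (q + 1) ≤ u / (4 * k) + 1 → ¬ Zf u)
    (hωinj : ∀ q m, Function.Injective (ω q m))
    (u : ℕ) (c c' : Fin (k + 1)) (h : c ≠ c') (hc : c = 0 → Zf u) (hc' : c' = 0 → Zf u) :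
    stt hk Zf E sec cq π ω u c ≠ stt hk Zf E sec cq π ω u c' := by
  unfold stt
  by_cases hb : 1 ≤ sec (u / (4 * k)) ∧ u / (4 * k) = E (sec (u / (4 * k)))
  · rw [if_pos hb, if_pos hb]
    have hz : ¬ Zf u := by
      apply hfree (sec (u / (4 * k)) - 1)
      · rw [Nat.sub_add_cancel hb.1, ← hb.2]; omega
      · rw [Nat.sub_add_cancel hb.1, ← hb.2]; omega
    have h0 : c ≠ 0 := fun e => hz (hc e)
    have h0' : c' ≠ 0 := fun e => hz (hc' e)
    rw [if_neg h0, if_neg h0']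
    exact fun hh => h (finPr_inj hk _ _ h0 h0' (hωinj _ _ hh))
  · rw [if_neg hb, if_neg hb]
    exact kap_ne hk _ _ _ _ _ h (Or.inl rfl)

lemma stt_succ {k : ℕ} (hk : 1 ≤ k) (Zf : ℕ → Prop) (E sec : ℕ → ℕ)
    (cq : ℕ → Fin (k + 1)) (π : ℕ → Equiv.Perm (Fin k))
    (ω : ℕ → ℕ → Fin k → Option (Fin k))
    (hE2 : ∀ q, E q + 2 ≤ E (q + 1))
    (hsec : ∀ b, E (sec b) ≤ b ∧ b < E (sec b + 1))
    (hfree : ∀ q u, u / (4 * k) ≤ E (q + 1) + 1 → E (q + 1) ≤ u / (4 * k) + 1 → ¬ Zf u)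
    (hω0 : ∀ q c, ω q 0 c = some (π q c))
    (hω1 : ∀ q m, 3 * k ≤ m → ∀ c, ω q m c = some (π (q + 1) c))
    (hωs : ∀ q m c c', c ≠ c' → ω q m c ≠ ω q (m + 1) c')
    (u : ℕ) (c c' : Fin (k + 1)) (h : c ≠ c') (hc : c = 0 → Zf u) (hc' : c' = 0 → Zf (u + 1)) :
    stt hk Zf E sec cq π ω u c ≠ stt hk Zf E sec cq π ω (u + 1) c' ∧
    (sec (u / (4 * k)) ≠ sec ((u + 1) / (4 * k)) →
      sec ((u + 1) / (4 * k)) = sec (u / (4 * k)) + 1 ∧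
      stt hk Zf E sec cq π ω u c ≠ none ∧ stt hk Zf E sec cq π ω (u + 1) c' ≠ none) := by
  have hmono : StrictMono E := strictMono_nat_of_lt_succ fun q => by have := hE2 q; omega
  have hK : 4 ≤ 4 * k := by omega
  generalize hKK : 4 * k = K at *
  have hk3 : 3 * k + 1 ≤ K := by omega
  obtain ⟨b, m, hm, rfl⟩ : ∃ b m, m < K ∧ u = K * b + m :=
    ⟨u / K, u % K, Nat.mod_lt _ (by omega), (Nat.div_add_mod u K).symm⟩
  have hb : (K * b + m) / K = b := divK (by omega) (by omega)
  have hmm : (K * b + m) % K = m := by rw [Nat.mul_add_mod]; exact Nat.mod_eq_of_lt hm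
  -- no zeros in the `W`-neighbourhood
  have hWfree : ∀ q v x, v = K * x → E (q + 1) = x → ∀ y, v ≤ y + 1 → y ≤ v + K → ¬ Wset Zf y := by
    intro q v x hv hx y h1 h2
    have hf : ∀ y', v ≤ y' + 2 → y' ≤ v + K + 1 → ¬ Zf y' := by
      intro y' g1 g2
      apply hfree q y'
      · rw [hx]
        have : y' < K * (x + 2) := by rw [mul_add]; omega
        have := Nat.div_lt_of_lt_mul this
        omega
      · rw [hx]
        have : x = v / K := by rw [hv, Nat.mul_div_cancel_left _ (by omega)]
        rw [this]
        exact div_step (by omega) (by omega)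
    rintro (hz | hz | hz)
    · exact hf _ (by omega) (by omega) hz
    · exact hf _ (by omega) (by omega) hz
    · exact hf _ (by omega) (by omega) hz
  by_cases hlast : m + 1 < K
  · -- same block
    have hb' : (K * b + m + 1) / K = b := divK (by omega) (by omega)
    have hmm' : (K * b + m + 1) % K = m + 1 := by
      rw [add_assoc, Nat.mul_add_mod]; exact Nat.mod_eq_of_lt hlast
    refine ⟨?_, fun hne => absurd (by rw [hb, hb']) hne⟩
    unfold stt
    rw [hKK, hb, hb', hmm, hmm']
    by_cases hbuf : 1 ≤ sec b ∧ b = E (sec b)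
    · rw [if_pos hbuf, if_pos hbuf]
      have hE1 : E (sec b - 1 + 1) = b := by rw [Nat.sub_add_cancel hbuf.1, ← hbuf.2]
      have h0 : c ≠ 0 := fun e => hfree (sec b - 1) _ (by rw [hE1, hb]; omega)
        (by rw [hE1, hb]; omega) (hc e)
      have h0' : c' ≠ 0 := fun e => hfree (sec b - 1) _ (by rw [hE1, hb']; omega)
        (by rw [hE1, hb']; omega) (hc' e)
      rw [if_neg h0, if_neg h0']
      exact hωs _ _ _ _ (fun e => h (finPr_inj hk _ _ h0 h0' e))
    · rw [if_neg hbuf, if_neg hbuf]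
      apply kap_ne hk _ _ _ _ _ h
      by_cases w1 : Wset Zf (K * b + m) <;> by_cases w2 : Wset Zf (K * b + m + 1)
      · left; simp [ccol, w1, w2]
      · right
        refine ⟨fun e => w2 (Or.inl (by simpa using hc e)), fun e => w2 (Or.inr (Or.inl (hc' e))),
          Or.inr (by simp [ccol, w2])⟩
      · right
        refine ⟨fun e => w1 (Or.inr (Or.inl (hc e))), fun e => w1 (Or.inr (Or.inr (hc' e))),
          Or.inl (by simp [ccol, w1])⟩
      · left; simp [ccol, w1, w2]
  · have hm1 : m + 1 = K := by omega
    have hu1 : K * b + m + 1 = K * (b + 1) := by rw [mul_add]; omega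
    have hb' : (K * b + m + 1) / K = b + 1 := by
      rw [hu1, Nat.mul_div_cancel_left _ (by omega)]
    have hmm' : (K * b + m + 1) % K = 0 := by
      rw [hu1]; exact Nat.mul_mod_right _ _
    have hmono2 := hE2 (sec b)
    have hs := hsec b
    by_cases hnext : b + 1 < E (sec b + 1)
    · -- same section
      have hs' : sec (b + 1) = sec b := sec_unique E sec hmono hsec _ _ (by omega) hnext
      refine ⟨?_, fun hne => absurd (by rw [hb, hb', hs']) hne⟩
      unfold stt
      rw [hKK, hb, hb', hmm, hmm', hs']
      rw [if_neg (c := 1 ≤ sec b ∧ b + 1 = E (sec b)) (by omega)]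
      by_cases hbuf : 1 ≤ sec b ∧ b = E (sec b)
      · rw [if_pos hbuf]
        have hE1 : E (sec b - 1 + 1) = b := by rw [Nat.sub_add_cancel hbuf.1, ← hbuf.2]
        have h0 : c ≠ 0 := fun e => hfree (sec b - 1) _ (by rw [hE1, hb]; omega)
          (by rw [hE1, hb]; omega) (hc e)
        have h0' : c' ≠ 0 := fun e => hfree (sec b - 1) _ (by rw [hE1, hb'])
          (by rw [hE1, hb']; omega) (hc' e)
        have hw : ¬ Wset Zf (K * b + m + 1) :=
          hWfree (sec b - 1) (K * b) b rfl hE1 _ (by omega) (by omega)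
        rw [if_neg h0, ccol, if_neg hw, hω1 _ _ (by omega), kap_zero hk _ _ h0',
          Nat.sub_add_cancel hbuf.1]
        intro hh
        exact h (finPr_inj hk _ _ h0 h0' ((π (sec b)).injective (by simpa using hh)))
      · rw [if_neg hbuf]
        apply kap_ne hk _ _ _ _ _ h
        by_cases w1 : Wset Zf (K * b + m) <;> by_cases w2 : Wset Zf (K * b + m + 1)
        · left; simp [ccol, w1, w2]
        · right
          refine ⟨fun e => w2 (Or.inl (by simpa using hc e)), fun e => w2 (Or.inr (Or.inl (hc' e))),
            Or.inr (by simp [ccol, w2])⟩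
        · right
          refine ⟨fun e => w1 (Or.inr (Or.inl (hc e))), fun e => w1 (Or.inr (Or.inr (hc' e))),
            Or.inl (by simp [ccol, w1])⟩
        · left; simp [ccol, w1, w2]
    · have hE1 : E (sec b + 1) = b + 1 := by omega
      have hE3 := hE2 (sec b + 1)
      have hs' : sec (b + 1) = sec b + 1 :=
        sec_unique E sec hmono hsec _ _ (by omega) (by omega)
      have h0 : c ≠ 0 := fun e => hfree (sec b) _ (by rw [hE1, hb]; omega)
          (by rw [hE1, hb]) (hc e)
      have h0' : c' ≠ 0 := fun e => hfree (sec b) _ (by rw [hE1, hb']; omega)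
          (by rw [hE1, hb']; omega) (hc' e)
      have hw : ¬ Wset Zf (K * b + m) :=
        hWfree (sec b) (K * (b + 1)) (b + 1) rfl hE1 _ (by omega) (by omega)
      have e1 : stt hk Zf E sec cq π ω (K * b + m) c = some (π (sec b) (finPr hk c)) := by
        unfold stt
        rw [hKK, hb, if_neg (by omega), ccol, if_neg hw, kap_zero hk _ _ h0]
      have e2 : stt hk Zf E sec cq π ω (K * b + m + 1) c' = some (π (sec b) (finPr hk c')) := by
        unfold stt
        rw [hKK, hb', hs', hmm', if_pos ⟨by omega, hE1.symm⟩, if_neg h0', Nat.add_sub_cancel, hω0]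
      rw [e1, e2, hb, hb', hs']
      refine ⟨?_, fun _ => ⟨rfl, by simp, by simp⟩⟩
      intro hh
      exact h (finPr_inj hk _ _ h0 h0' ((π (sec b)).injective (by simpa using hh)))

def plc {r k : ℕ} (z : Fin r → Fin r × Fin k) (i : Fin r) : Option (Fin k) → Fin r × Fin k
  | none => z i
  | some j => (i, j)

lemma plc_adj {r k : ℕ} (R : SimpleGraph (Fin r × Fin k)) (hR : Bgraph r k ≤ R)
    (z : Fin r → Fin r × Fin k) (hz : ∀ i j, R.Adj (z i) (i, j)) (i : Fin r)
    (s s' : Option (Fin k)) (h : s ≠ s') : R.Adj (plc z i s) (plc z i s') := by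
  rcases s with _ | a <;> rcases s' with _ | b
  · exact absurd rfl h
  · exact hz i b
  · exact (hz i a).symm
  · have hab : a ≠ b := fun e => h (by rw [e])
    apply hR
    simp only [plc, Bgraph, SimpleGraph.fromRel_adj]
    refine ⟨fun e => hab (by simpa using e), Or.inl ⟨⟨by omega, by omega⟩, hab⟩⟩

lemma plc_adj' {r k : ℕ} (R : SimpleGraph (Fin r × Fin k)) (hR : Bgraph r k ≤ R)
    (z : Fin r → Fin r × Fin k) (i i' : Fin r) (hi : (i' : ℕ) = i + 1 ∨ (i' : ℕ) = i)
    (s s' : Option (Fin k)) (h : s ≠ s') (h1 : s ≠ none) (h2 : s' ≠ none) :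
    R.Adj (plc z i s) (plc z i' s') := by
  rcases s with _ | a <;> rcases s' with _ | b
  · exact absurd rfl h
  · exact absurd rfl h1
  · exact absurd rfl h2
  · have hab : a ≠ b := fun e => h (by rw [e])
    apply hR
    simp only [plc, Bgraph, SimpleGraph.fromRel_adj]
    refine ⟨fun e => hab (by simp at e; exact e.2), Or.inl ⟨⟨by omega, by omega⟩, hab⟩⟩


lemma sum_fib {V : Type} (Q : ℕ) (qv : V → ℕ) (hQ : ∀ v, qv v < Q) (s : Finset V) :
    ∑ q : Fin Q, ((s.filter (fun v => qv v = (q : ℕ))).card : ℝ) = s.card := by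
  rw [Fin.sum_univ_eq_sum_range (fun q => ((s.filter (fun v => qv v = q)).card : ℝ)) Q]
  rw [Finset.card_eq_sum_card_fiberwise (f := qv) (t := Finset.range Q) (s := s)]
  · push_cast; rfl
  · intro v _; simpa using hQ v

set_option maxHeartbeats 1000000 in
open Classical in
lemma balance {n r k Q : ℕ} [NeZero k] (qv : Fin n → ℕ) (hQ : ∀ v, qv v < Q) (hQ0 : 0 < Q)
    (core low : Fin n → Prop) [DecidablePred low] (virt : Fin n → Option (Fin k))
    (idx : ℕ → Fin r) (z : Fin r → Fin r × Fin k) (amax : ℝ) (b0 : ℕ)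
    (hamax : ∀ q, ((Finset.univ.filter (fun v => core v ∧ qv v = q)).card : ℝ) ≤ amax) :
    ∃ τ : ℕ → Fin k, ∀ f : Fin n → Fin r × Fin k,
      (∀ v, core v → f v = plc z (idx (qv v)) ((virt v).map (fun c => c + τ (qv v)))) →
      ∀ i j,
        (((Finset.univ.filter (fun v => idx (qv v) = i)).card : ℝ)
            - (Finset.univ.filter (fun v => ¬ core v)).card
            - (Finset.univ.filter (fun v => core v ∧ virt v = none)).card) / k
              - 2 * r * k * amax ≤ ((Finset.univ.filter (fun v => f v = (i, j))).card : ℝ) ∧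
        ((Finset.univ.filter (fun v => f v = (i, j))).card : ℝ) ≤
          ((Finset.univ.filter (fun v => idx (qv v) = i)).card : ℝ) / k + 2 * r * k * amax
            + (Finset.univ.filter (fun v => ¬ core v)).card
            + (Finset.univ.filter (fun v => core v ∧ virt v = none)).card ∧
        ∀ N : Finset ℕ, (∀ q ∈ N, q < Q ∧ idx q = i ∧ b0 ≤
            (Finset.univ.filter (fun v => core v ∧ qv v = q ∧ low v ∧ virt v ≠ none)).card) →
          (b0 : ℝ) * N.card / k - 2 * r * k * b0 ≤
            ((Finset.univ.filter (fun v => f v = (i, j) ∧ low v)).card : ℝ) := by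
  have hBex : ∀ q, ∃ B : Finset (Fin n),
      B ⊆ Finset.univ.filter (fun v => core v ∧ qv v = q ∧ low v ∧ virt v ≠ none) ∧
      B.card = min b0
        (Finset.univ.filter (fun v => core v ∧ qv v = q ∧ low v ∧ virt v ≠ none)).card := by
    intro q
    exact Finset.exists_subset_card_eq (min_le_right _ _)
  choose Bs hBs hBc using hBex
  let A : ℕ → Fin k → ℝ := fun q c =>
    ((Finset.univ.filter (fun v => core v ∧ qv v = q ∧ virt v = some c)).card : ℝ)
  let Bf : ℕ → Fin k → ℝ := fun q c => (((Bs q).filter (fun v => virt v = some c)).card : ℝ)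
  let x : Fin Q → Fin k → (Fin r × Fin k × Bool) → ℝ := fun q t a =>
    if idx q = a.1 then (if a.2.2 then Bf q (a.2.1 - t) else A q (a.2.1 - t)) else 0
  let BB : (Fin r × Fin k × Bool) → ℝ := fun a => if a.2.2 then (b0 : ℝ) else amax
  have hA0 : ∀ q c, 0 ≤ A q c := fun q c => by positivity
  have hB0 : ∀ q c, 0 ≤ Bf q c := fun q c => by positivity
  have hA1 : ∀ q c, A q c ≤ amax := by
    intro q c
    refine le_trans ?_ (hamax q)
    refine Nat.cast_le.mpr (Finset.card_le_card ?_)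
    intro v hv; simp only [Finset.mem_filter, Finset.mem_univ, true_and] at hv ⊢; exact ⟨hv.1, hv.2.1⟩
  have hB1 : ∀ q c, Bf q c ≤ b0 := by
    intro q c
    simp only [Bf]
    have h1 : ((Bs q).filter (fun v => virt v = some c)).card ≤ (Bs q).card :=
      Finset.card_filter_le _ _
    have h2 : (Bs q).card ≤ b0 := by rw [hBc]; exact min_le_left _ _
    exact_mod_cast h1.trans h2
  have ham0 : 0 ≤ amax := le_trans (by positivity) (hamax 0)
  haveI : Nonempty (Fin Q) := ⟨⟨0, hQ0⟩⟩
  obtain ⟨τ, hτ⟩ := rounding x BB (by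
      intro s t a
      simp only [x]
      split_ifs
      · exact hB0 _ _
      · exact hA0 _ _
      · exact le_rfl) (by
      intro s t a
      simp only [x, BB]
      split_ifs
      all_goals first | exact hB1 _ _ | exact hA1 _ _ | exact ham0 | exact Nat.cast_nonneg _)
  let τ' : ℕ → Fin k := fun q => if h : q < Q then τ ⟨q, h⟩ else 0
  have hτ' : ∀ q : Fin Q, τ' q = τ q := fun q => by simp [τ']
  refine ⟨τ', fun f hf i j => ?_⟩
  have hcard : (Fintype.card (Fin r × Fin k × Bool) : ℝ) = 2 * r * k := by
    simp; ring
  have hk0 : (0 : ℝ) < k := by exact_mod_cast Nat.pos_of_ne_zero (NeZero.ne k)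
  have rot : ∀ g : Fin k → ℝ, ∑ t, g (j - t) = ∑ t, g t := fun g =>
    Equiv.sum_comp (Equiv.subLeft j) g
  -- the chosen class
  let SA := Finset.univ.filter (fun v => core v ∧ idx (qv v) = i ∧ virt v = some (j - τ' (qv v)))
  let TA := Finset.univ.filter (fun v => core v ∧ idx (qv v) = i ∧ virt v ≠ none)
  have hSA : ∑ q : Fin Q, x q (τ q) (i, j, false) = SA.card := by
    rw [← sum_fib Q qv hQ SA]
    refine Finset.sum_congr rfl fun q _ => ?_
    simp only [x, A]
    by_cases hi : idx q = i
    · simp only [hi, if_true, Bool.false_eq_true, if_false]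
      congr 2
      ext v
      simp only [SA, Finset.mem_filter, Finset.mem_univ, true_and]
      constructor
      · rintro ⟨h1, h2, h3⟩; rw [h2, hτ']; exact ⟨⟨h1, hi, h3⟩, rfl⟩
      · rintro ⟨⟨h1, h2, h3⟩, h4⟩; rw [h4, hτ'] at h3; exact ⟨h1, h4, h3⟩
    · simp only [hi, if_false]
      symm
      rw [Nat.cast_eq_zero, Finset.card_eq_zero, Finset.filter_eq_empty_iff]
      intro v hv hq
      simp only [SA, Finset.mem_filter, Finset.mem_univ, true_and] at hv
      rw [hq] at hv
      exact hi hv.2.1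
  have hTA : ∑ q : Fin Q, (∑ t, x q t (i, j, false)) / (Fintype.card (Fin k) : ℝ)
      = TA.card / k := by
    rw [← Finset.sum_div, Fintype.card_fin, ← sum_fib Q qv hQ TA]
    congr 1
    refine Finset.sum_congr rfl fun q _ => ?_
    simp only [x]
    by_cases hi : idx q = i
    · simp only [hi, if_true, Bool.false_eq_true, if_false]
      rw [rot]
      simp only [A]
      have := Finset.card_eq_sum_card_fiberwise (f := virt)
        (s := TA.filter (fun v => qv v = q)) (t := Finset.univ.image some) (by
          intro v hv
          simp only [TA, Finset.coe_filter, Finset.mem_filter, Finset.mem_univ, true_and, Set.mem_ofPred_eq] at hv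
          obtain ⟨c, hc⟩ := Option.ne_none_iff_exists'.mp hv.1.2.2
          simp [hc])
      rw [this, Finset.sum_image (by intro a _ b _ h; simpa using h)]
      push_cast
      refine Finset.sum_congr rfl fun c _ => ?_
      congr 2
      ext v
      simp only [TA, Finset.mem_filter, Finset.mem_univ, true_and]
      constructor
      · rintro ⟨h1, h2, h3⟩; refine ⟨⟨⟨h1, by rw [h2]; exact hi, by simp [h3]⟩, h2⟩, h3⟩
      · rintro ⟨⟨⟨h1, h2, h3⟩, h4⟩, h5⟩; exact ⟨h1, h4, h5⟩
    · simp only [hi, if_false, Finset.sum_const_zero]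
      symm
      rw [Nat.cast_eq_zero, Finset.card_eq_zero, Finset.filter_eq_empty_iff]
      intro v hv hq
      simp only [TA, Finset.mem_filter, Finset.mem_univ, true_and] at hv
      rw [hq] at hv
      exact hi hv.2.1
  have hdA := hτ (i, j, false)
  rw [hSA, hTA, hcard] at hdA
  simp only [BB, Bool.false_eq_true, if_false] at hdA
  rw [abs_le] at hdA
  -- comparison of `TA` with the section
  have hT1 : TA.card ≤ (Finset.univ.filter (fun v => idx (qv v) = i)).card := by
    apply Finset.card_le_card
    intro v hv
    simp only [TA, Finset.mem_filter, Finset.mem_univ, true_and] at hv ⊢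
    exact hv.2.1
  have hT2 : (Finset.univ.filter (fun v => idx (qv v) = i)).card ≤ TA.card
      + (Finset.univ.filter (fun v => ¬ core v)).card
      + (Finset.univ.filter (fun v => core v ∧ virt v = none)).card := by
    refine le_trans (Finset.card_le_card (t := (TA ∪ Finset.univ.filter (fun v => ¬ core v)) ∪
      Finset.univ.filter (fun v => core v ∧ virt v = none)) ?_) ?_
    · intro v hv
      simp only [TA, Finset.mem_filter, Finset.mem_univ, true_and, Finset.mem_union] at hv ⊢
      tauto
    · exact (Finset.card_union_le _ _).trans (Nat.add_le_add_right (Finset.card_union_le _ _) _)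
  have hS1 : SA.card ≤ (Finset.univ.filter (fun v => f v = (i, j))).card := by
    apply Finset.card_le_card
    intro v hv
    simp only [SA, Finset.mem_filter, Finset.mem_univ, true_and] at hv ⊢
    rw [hf v hv.1, hv.2.2, hv.2.1]
    simp [plc]
  have hS2 : (Finset.univ.filter (fun v => f v = (i, j))).card ≤ SA.card
      + (Finset.univ.filter (fun v => ¬ core v)).card
      + (Finset.univ.filter (fun v => core v ∧ virt v = none)).card := by
    refine le_trans (Finset.card_le_card (t := (SA ∪ Finset.univ.filter (fun v => ¬ core v)) ∪
      Finset.univ.filter (fun v => core v ∧ virt v = none)) ?_) ?_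
    · intro v hv
      simp only [SA, Finset.mem_filter, Finset.mem_univ, true_and, Finset.mem_union] at hv ⊢
      by_cases hc : core v
      · rcases hvi : virt v with _ | c
        · tauto
        · left; left
          rw [hf v hc, hvi] at hv
          simp only [Option.map_some, plc, Prod.mk.injEq] at hv
          refine ⟨hc, hv.1, ?_⟩
          rw [← hv.2]; simp
      · tauto
    · exact (Finset.card_union_le _ _).trans (Nat.add_le_add_right (Finset.card_union_le _ _) _)
  have hT1' : (TA.card : ℝ) ≤ (Finset.univ.filter (fun v => idx (qv v) = i)).card := by
    exact_mod_cast hT1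
  have hT2' : ((Finset.univ.filter (fun v => idx (qv v) = i)).card : ℝ) ≤ TA.card
      + (Finset.univ.filter (fun v => ¬ core v)).card
      + (Finset.univ.filter (fun v => core v ∧ virt v = none)).card := by exact_mod_cast hT2
  have hS1' : (SA.card : ℝ) ≤ (Finset.univ.filter (fun v => f v = (i, j))).card := by
    exact_mod_cast hS1
  have hS2' : ((Finset.univ.filter (fun v => f v = (i, j))).card : ℝ) ≤ SA.card
      + (Finset.univ.filter (fun v => ¬ core v)).card
      + (Finset.univ.filter (fun v => core v ∧ virt v = none)).card := by exact_mod_cast hS2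
  refine ⟨?_, ?_, ?_⟩
  · have : (((Finset.univ.filter (fun v => idx (qv v) = i)).card : ℝ)
            - (Finset.univ.filter (fun v => ¬ core v)).card
            - (Finset.univ.filter (fun v => core v ∧ virt v = none)).card) / k ≤ TA.card / k := by
      apply div_le_div_of_nonneg_right _ hk0.le
      linarith
    linarith [hdA.1]
  · have : (TA.card : ℝ) / k ≤ (Finset.univ.filter (fun v => idx (qv v) = i)).card / k :=
      div_le_div_of_nonneg_right hT1' hk0.le
    linarith [hdA.2]
  · intro N hN
    have hdB := hτ (i, j, true)
    rw [hcard] at hdB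
    simp only [BB, if_true] at hdB
    rw [abs_le] at hdB
    have hB2 : ∑ q : Fin Q, x q (τ q) (i, j, true) ≤
        ((Finset.univ.filter (fun v => f v = (i, j) ∧ low v)).card : ℝ) := by
      rw [← sum_fib Q qv hQ]
      refine Finset.sum_le_sum fun q _ => ?_
      simp only [x, if_true]
      by_cases hi : idx q = i
      · rw [if_pos hi]
        refine Nat.cast_le.mpr (Finset.card_le_card ?_)
        intro v hv
        simp only [Finset.mem_filter, Finset.mem_univ, true_and] at hv ⊢
        have hv1 := hBs _ hv.1
        simp only [Finset.mem_filter, Finset.mem_univ, true_and] at hv1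
        refine ⟨⟨?_, hv1.2.2.1⟩, hv1.2.1⟩
        rw [hf v hv1.1, hv.2, hv1.2.1, hi, hτ']
        simp [plc]
      · rw [if_neg hi]; exact Nat.cast_nonneg _
    have hB3 : (b0 : ℝ) * N.card / k ≤
        ∑ q : Fin Q, (∑ t, x q t (i, j, true)) / (Fintype.card (Fin k) : ℝ) := by
      rw [← Finset.sum_div, Fintype.card_fin]
      apply div_le_div_of_nonneg_right _ hk0.le
      have h1 : ∀ q : Fin Q, (if (q : ℕ) ∈ N then (b0 : ℝ) else 0) ≤ ∑ t, x q t (i, j, true) := by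
        intro q
        by_cases hq : (q : ℕ) ∈ N
        · obtain ⟨_, hq2, hq3⟩ := hN q hq
          simp only [hq, if_true, x, hq2]
          rw [rot]
          have hc : (Bs q).card = b0 := by rw [hBc]; exact min_eq_left hq3
          have := Finset.card_eq_sum_card_fiberwise (f := virt)
            (s := Bs q) (t := Finset.univ.image some) (by
              intro v hv
              have hv1 := hBs _ hv
              simp only [Finset.mem_filter, Finset.mem_univ, true_and] at hv1
              obtain ⟨c, hc⟩ := Option.ne_none_iff_exists'.mp hv1.2.2.2
              simp [hc])
          rw [hc, Finset.sum_image (by intro a _ b _ h; simpa using h)] at this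
          rw [this]
          push_cast
          rfl
        · simp only [hq, if_false]
          refine Finset.sum_nonneg fun t _ => ?_
          simp only [x, if_true]
          split_ifs
          · exact hB0 _ _
          · exact le_rfl
      refine le_trans ?_ (Finset.sum_le_sum fun q _ => h1 q)
      rw [Fin.sum_univ_eq_sum_range (fun q => if q ∈ N then (b0 : ℝ) else 0) Q]
      rw [← Finset.sum_filter, Finset.sum_const, nsmul_eq_mul, mul_comm]
      have : N ⊆ (Finset.range Q).filter (fun q => q ∈ N) := by
        intro q hq
        exact Finset.mem_filter.mpr ⟨Finset.mem_range.mpr (hN q hq).1, hq⟩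
      exact mul_le_mul_of_nonneg_right (Nat.cast_le.mpr (Finset.card_le_card this))
        (Nat.cast_nonneg _)
    linarith [hdB.1]


lemma u_exist {n : ℕ} (L : Equiv.Perm (Fin n)) (h : ℝ) (hh : 0 < h) :
    ∃ u : Fin n → ℕ, ∀ v, (u v : ℝ) * h < ((L v : ℕ) : ℝ) + 1 ∧
      ((L v : ℕ) : ℝ) + 1 ≤ ((u v : ℝ) + 1) * h := by
  have : ∀ v, ∃ x : ℕ, (x : ℝ) * h < ((L v : ℕ) : ℝ) + 1 ∧
      ((L v : ℕ) : ℝ) + 1 ≤ ((x : ℝ) + 1) * h := by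
    intro v
    have hp : (0 : ℝ) < (((L v : ℕ) : ℝ) + 1) / h := by positivity
    obtain ⟨x, hx⟩ := Nat.exists_eq_succ_of_ne_zero (Nat.ceil_pos.mpr hp).ne'
    refine ⟨x, ?_, ?_⟩
    · rw [← lt_div_iff₀ hh]
      apply Nat.lt_ceil.mp
      omega
    · rw [← div_le_iff₀ hh]
      have := Nat.le_ceil ((((L v : ℕ) : ℝ) + 1) / h)
      rw [hx] at this
      push_cast at this
      exact this
  choose u hu using this
  exact ⟨u, hu⟩

lemma bl_bd {k u : ℕ} (hk : 1 ≤ k) (h x : ℝ) (hh : 0 < h) (h1 : (u : ℝ) * h < x)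
    (h2 : x ≤ ((u : ℝ) + 1) * h) :
    ((u / (4 * k) : ℕ) : ℝ) * (4 * k * h) < x ∧
      x ≤ (((u / (4 * k) : ℕ) : ℝ) + 1) * (4 * k * h) := by
  have a : (u / (4 * k)) * (4 * k) ≤ u := Nat.div_mul_le_self _ _
  have b : u + 1 ≤ (u / (4 * k) + 1) * (4 * k) := by
    have := Nat.lt_div_mul_add (a := u) (b := 4 * k) (by omega)
    rw [add_mul, one_mul]; omega
  have a' : ((u / (4 * k) : ℕ) : ℝ) * (4 * k) ≤ u := by exact_mod_cast a
  have b' : (u : ℝ) + 1 ≤ (((u / (4 * k) : ℕ) : ℝ) + 1) * (4 * k) := by exact_mod_cast b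
  have a2 := mul_le_mul_of_nonneg_right a' hh.le
  have b2 := mul_le_mul_of_nonneg_right b' hh.le
  constructor
  · linarith
  · linarith

lemma lt_of_mul_lt' {a b : ℕ} {w x : ℝ} (hw : 0 < w) (h1 : (a : ℝ) * w < x)
    (h2 : x ≤ (b : ℝ) * w) : a < b := by
  have := lt_of_lt_of_le h1 h2
  exact_mod_cast lt_of_mul_lt_mul_right this hw.le

lemma H3_lem {n r k : ℕ} (hk : 1 ≤ k) (H : SimpleGraph (Fin n)) (σ : Fin n → Fin (k + 1))
    (hσ : ∀ u v, H.Adj u v → σ u ≠ σ v)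
    (R : SimpleGraph (Fin r × Fin k)) (hR : Bgraph r k ≤ R)
    (z : Fin r → Fin r × Fin k) (hz : ∀ i j, R.Adj (z i) (i, j))
    (u : Fin n → ℕ) (hu : ∀ x y, H.Adj x y → u x ≤ u y + 1)
    (E sec : ℕ → ℕ) (cq : ℕ → Fin (k + 1)) (π : ℕ → Equiv.Perm (Fin k))
    (ω : ℕ → ℕ → Fin k → Option (Fin k)) (idx : ℕ → Fin r)
    (hidx : ∀ q, (idx (q + 1) : ℕ) = idx q + 1 ∨ (idx (q + 1) : ℕ) = idx q)
    (Zf : ℕ → Prop) (hZf : ∀ v, σ v = 0 → Zf (u v))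
    (hE2 : ∀ q, E q + 2 ≤ E (q + 1))
    (hsec : ∀ b, E (sec b) ≤ b ∧ b < E (sec b + 1))
    (hfree : ∀ q u, u / (4 * k) ≤ E (q + 1) + 1 → E (q + 1) ≤ u / (4 * k) + 1 → ¬ Zf u)
    (hω0 : ∀ q c, ω q 0 c = some (π q c))
    (hω1 : ∀ q m, 3 * k ≤ m → ∀ c, ω q m c = some (π (q + 1) c))
    (hωinj : ∀ q m, Function.Injective (ω q m))
    (hωs : ∀ q m c c', c ≠ c' → ω q m c ≠ ω q (m + 1) c')
    (x y : Fin n) (hxy : H.Adj x y) :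
    R.Adj (plc z (idx (sec (u x / (4 * k)))) (stt hk Zf E sec cq π ω (u x) (σ x)))
      (plc z (idx (sec (u y / (4 * k)))) (stt hk Zf E sec cq π ω (u y) (σ y))) := by
  have key : ∀ x y, H.Adj x y → u y = u x + 1 →
      R.Adj (plc z (idx (sec (u x / (4 * k)))) (stt hk Zf E sec cq π ω (u x) (σ x)))
      (plc z (idx (sec (u y / (4 * k)))) (stt hk Zf E sec cq π ω (u y) (σ y))) := by
    intro x y hxy hh
    have := stt_succ hk Zf E sec cq π ω hE2 hsec hfree hω0 hω1 hωs (u x) (σ x) (σ y)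
      (hσ _ _ hxy) (hZf x) (fun e => hh ▸ hZf y e)
    rw [← hh] at this
    obtain ⟨h1, h2⟩ := this
    by_cases hs : sec (u x / (4 * k)) = sec (u y / (4 * k))
    · rw [hs]
      exact plc_adj R hR z hz _ _ _ h1
    · obtain ⟨g1, g2, g3⟩ := h2 hs
      rw [g1]
      exact plc_adj' R hR z _ _ (hidx _) _ _ h1 g2 g3
  rcases lt_trichotomy (u x) (u y) with h | h | h
  · exact key x y hxy (by have := hu y x hxy.symm; omega)
  · rw [← h]
    apply plc_adj R hR z hz
    exact stt_same hk Zf E sec cq π ω hfree hωinj _ _ _ (hσ _ _ hxy) (hZf x)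
      (fun e => h ▸ hZf y e)
  · exact (key y x hxy.symm (by have := hu x y hxy; omega)).symm

lemma H4_lem {r k : ℕ} (hk : 1 ≤ k)
    (z : Fin r → Fin r × Fin k)
    (E sec : ℕ → ℕ) (cq : ℕ → Fin (k + 1)) (π : ℕ → Equiv.Perm (Fin k))
    (ω : ℕ → ℕ → Fin k → Option (Fin k)) (idx : ℕ → Fin r)
    (Zf : ℕ → Prop) (hE0 : E 0 = 0)
    (hE2 : ∀ q, E q + 2 ≤ E (q + 1))
    (hsec : ∀ b, E (sec b) ≤ b ∧ b < E (sec b + 1))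
    (ux uy : ℕ) (c : Fin (k + 1)) (hc : c = 0 → Zf uy)
    (h1 : uy ≤ ux + 2) (h2 : ux ≤ uy + 2)
    (hX1 : ∀ u', u' / (4 * k) ≤ ux / (4 * k) + 1 → ux / (4 * k) ≤ u' / (4 * k) + 1 → ¬ Zf u')
    (hX2 : ∀ q, E (q + 1) ≤ ux / (4 * k) + 1 → ux / (4 * k) ≤ E (q + 1) + 1 → False) :
    (plc z (idx (sec (uy / (4 * k)))) (stt hk Zf E sec cq π ω uy c)).1
      = idx (sec (ux / (4 * k))) := by
  have hmono : StrictMono E := strictMono_nat_of_lt_succ fun q => by have := hE2 q; omega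
  have d1 : uy / (4 * k) ≤ ux / (4 * k) + 1 := div_step (by omega) (by omega)
  have d2 : ux / (4 * k) ≤ uy / (4 * k) + 1 := div_step (by omega) (by omega)
  have hz : ∀ u', u' ≤ uy + 1 → uy ≤ u' + 1 → ¬ Zf u' := fun u' g1 g2 =>
    hX1 u' (div_step (by omega) (by omega)) (div_step (by omega) (by omega))
  have hW : ¬ Wset Zf uy := by
    rintro (h | h | h)
    · exact hz _ (by omega) (by omega) h
    · exact hz _ (by omega) (by omega) h
    · exact hz _ (by omega) (by omega) h
  have hc0 : c ≠ 0 := fun e => hz _ (by omega) (by omega) (hc e)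
  have hs := hsec (ux / (4 * k))
  have e1 : ux / (4 * k) + 1 < E (sec (ux / (4 * k)) + 1) := by
    by_contra hh
    exact hX2 (sec (ux / (4 * k))) (by omega) (by omega)
  have e2 : 1 ≤ sec (ux / (4 * k)) → E (sec (ux / (4 * k))) + 1 < ux / (4 * k) := by
    intro g
    by_contra hh
    apply hX2 (sec (ux / (4 * k)) - 1) <;> rw [Nat.sub_add_cancel g] <;> omega
  have e3 : E (sec (ux / (4 * k))) ≤ uy / (4 * k) := by
    rcases Nat.eq_zero_or_pos (sec (ux / (4 * k))) with g | g
    · rw [g, hE0]; exact Nat.zero_le _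
    · have := e2 g; omega
  have hsy : sec (uy / (4 * k)) = sec (ux / (4 * k)) :=
    sec_unique E sec hmono hsec _ _ e3 (by omega)
  have hst : stt hk Zf E sec cq π ω uy c = some (π (sec (ux / (4 * k))) (finPr hk c)) := by
    unfold stt
    rw [hsy, if_neg (by rintro ⟨g1, g2⟩; have := e2 g1; omega), ccol, if_neg hW,
      kap_zero hk _ _ hc0]
  rw [hst, hsy]
  rfl

open Classical in
lemma cq_exist {n k : ℕ} (hk : 1 ≤ k) (σ : Fin n → Fin (k + 1)) (P : ℕ → Fin n → Prop) :
    ∃ cq : ℕ → Fin (k + 1), ∀ q,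
      2 * (Finset.univ.filter (fun v => P q v ∧ σ v = cq q)).card ≤
        (Finset.univ.filter (fun v => P q v)).card := by
  have : ∀ q, ∃ c : Fin (k + 1),
      2 * (Finset.univ.filter (fun v => P q v ∧ σ v = c)).card ≤
        (Finset.univ.filter (fun v => P q v)).card := by
    intro q
    by_contra hh
    push Not at hh
    have h0 := hh 0
    have h1 := hh (Fin.last k)
    have hne : (0 : Fin (k + 1)) ≠ Fin.last k := by
      intro e
      have := congrArg Fin.val e
      simp at this
      omega
    have hd : Disjoint (Finset.univ.filter (fun v => P q v ∧ σ v = 0))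
        (Finset.univ.filter (fun v => P q v ∧ σ v = Fin.last k)) := by
      rw [Finset.disjoint_left]
      intro v hv hv'
      simp only [Finset.mem_filter, Finset.mem_univ, true_and] at hv hv'
      exact hne (hv.2.symm.trans hv'.2)
    have hc := Finset.card_union_of_disjoint hd
    have hle : ((Finset.univ.filter (fun v => P q v ∧ σ v = 0)) ∪
        (Finset.univ.filter (fun v => P q v ∧ σ v = Fin.last k))).card ≤
        (Finset.univ.filter (fun v => P q v)).card := by
      apply Finset.card_le_card
      intro v hv
      simp only [Finset.mem_filter, Finset.mem_univ, true_and, Finset.mem_union] at hv ⊢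
      tauto
    omega
  choose cq hcq using this
  exact ⟨cq, hcq⟩

open Classical in
/-- vertices in a range of blocks -/
lemma cnt_blocks {n : ℕ} (L : Equiv.Perm (Fin n)) (bl : Fin n → ℕ) (w : ℝ) (hw : 0 < w)
    (hbl : ∀ v, (bl v : ℝ) * w < ((L v : ℕ) : ℝ) + 1 ∧ ((L v : ℕ) : ℝ) + 1 ≤ ((bl v : ℝ) + 1) * w)
    (a b : ℝ) (hab : a ≤ b) (A : Finset (Fin n))
    (hA : ∀ v ∈ A, a ≤ bl v ∧ (bl v : ℝ) + 1 ≤ b) : (A.card : ℝ) ≤ (b - a) * w + 1 := by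
  have := label_le L (a * w) (b * w) (mul_le_mul_of_nonneg_right hab hw.le) A (by
    intro v hv
    obtain ⟨h1, h2⟩ := hA v hv
    have g1 := mul_le_mul_of_nonneg_right h1 hw.le
    have g2 := mul_le_mul_of_nonneg_right h2 hw.le
    have := hbl v
    constructor <;> linarith)
  linarith

open Classical in
lemma cnt_amax {n : ℕ} (L : Equiv.Perm (Fin n)) (bl : Fin n → ℕ) (w : ℝ) (hw : 0 < w)
    (hbl : ∀ v, (bl v : ℝ) * w < ((L v : ℕ) : ℝ) + 1 ∧ ((L v : ℕ) : ℝ) + 1 ≤ ((bl v : ℝ) + 1) * w)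
    (T1 l : ℕ) (E sec : ℕ → ℕ)
    (hE : ∀ q, T1 + q * l ≤ E (q + 1) ∧ E (q + 1) ≤ T1 + q * l + 3)
    (hsec : ∀ b, E (sec b) ≤ b ∧ b < E (sec b + 1)) (q : ℕ) :
    ((Finset.univ.filter (fun v => (1 ≤ sec (bl v) ∧ bl v ≠ E (sec (bl v))) ∧
      sec (bl v) = q)).card : ℝ) ≤ (l + 3) * w + 1 := by
  rcases q with _ | q
  · rw [Finset.filter_eq_empty_iff.mpr (by intro v _; omega)]
    simp only [Finset.card_empty, Nat.cast_zero]
    positivity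
  · have := cnt_blocks L bl w hw hbl ((E (q + 1) : ℕ) : ℝ) ((E (q + 1) : ℕ) + (l + 3 : ℕ) : ℝ)
      (by linarith [(Nat.cast_nonneg (l + 3) : (0 : ℝ) ≤ ((l + 3 : ℕ) : ℝ))])
      (Finset.univ.filter (fun v => (1 ≤ sec (bl v) ∧ bl v ≠ E (sec (bl v))) ∧
      sec (bl v) = q + 1)) (by
        intro v hv
        simp only [Finset.mem_filter, Finset.mem_univ, true_and] at hv
        have h1 := hsec (bl v)
        rw [hv.2] at h1
        have h2 := hE q
        have h3 := hE (q + 1)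
        rw [add_mul, one_mul] at h3
        constructor
        · exact_mod_cast h1.1
        · have : bl v + 1 ≤ E (q + 1) + (l + 3) := by omega
          exact_mod_cast this)
    push_cast at this
    linarith

open Classical in
lemma cnt_noncore {n : ℕ} (L : Equiv.Perm (Fin n)) (bl : Fin n → ℕ) (w : ℝ) (hw : 0 < w)
    (hbl : ∀ v, (bl v : ℝ) * w < ((L v : ℕ) : ℝ) + 1 ∧ ((L v : ℕ) : ℝ) + 1 ≤ ((bl v : ℝ) + 1) * w)
    (T1 l Q : ℕ) (E sec : ℕ → ℕ)
    (hE : ∀ q, T1 + q * l ≤ E (q + 1) ∧ E (q + 1) ≤ T1 + q * l + 3)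
    (hsec : ∀ b, E (sec b) ≤ b ∧ b < E (sec b + 1)) (hQ : ∀ v, sec (bl v) < Q) :
    ((Finset.univ.filter (fun v => ¬ (1 ≤ sec (bl v) ∧ bl v ≠ E (sec (bl v))))).card : ℝ)
      ≤ (T1 + 3) * w + 1 + Q * (w + 1) := by
  have hsub : (Finset.univ.filter (fun v => ¬ (1 ≤ sec (bl v) ∧ bl v ≠ E (sec (bl v))))) ⊆
      (Finset.univ.filter (fun v => sec (bl v) = 0)) ∪
      (Finset.range Q).biUnion (fun q => Finset.univ.filter (fun v => bl v = E q)) := by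
    intro v hv
    simp only [Finset.mem_filter, Finset.mem_univ, true_and, Finset.mem_union,
      Finset.mem_biUnion, Finset.mem_range] at hv ⊢
    by_cases h0 : sec (bl v) = 0
    · exact Or.inl h0
    · right
      refine ⟨sec (bl v), hQ v, ?_⟩
      by_contra hh
      exact hv ⟨by omega, hh⟩
  have h1 : ((Finset.univ.filter (fun v => sec (bl v) = 0)).card : ℝ) ≤ (T1 + 3) * w + 1 := by
    have := cnt_blocks L bl w hw hbl 0 (T1 + 3) (by positivity)
      (Finset.univ.filter (fun v => sec (bl v) = 0)) (by
        intro v hv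
        simp only [Finset.mem_filter, Finset.mem_univ, true_and] at hv
        have h1 := hsec (bl v)
        rw [hv] at h1
        have h2 := hE 0
        refine ⟨Nat.cast_nonneg _, ?_⟩
        have : bl v + 1 ≤ T1 + 3 := by omega
        exact_mod_cast this)
    linarith
  have h2 : (((Finset.range Q).biUnion (fun q => Finset.univ.filter
      (fun v => bl v = E q))).card : ℝ) ≤ Q * (w + 1) := by
    have : (((Finset.range Q).biUnion (fun q => Finset.univ.filter
      (fun v => bl v = E q))).card : ℝ) ≤ ∑ q ∈ Finset.range Q, ((Finset.univ.filter
      (fun v => bl v = E q)).card : ℝ) := by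
      exact_mod_cast Finset.card_biUnion_le
    refine this.trans ?_
    refine (Finset.sum_le_card_nsmul _ _ (w + 1) ?_).trans
      (by rw [nsmul_eq_mul, Finset.card_range])
    intro q _
    have := cnt_blocks L bl w hw hbl (E q) (E q + 1) (by linarith)
      (Finset.univ.filter (fun v => bl v = E q)) (by
        intro v hv
        simp only [Finset.mem_filter, Finset.mem_univ, true_and] at hv
        rw [hv]; exact ⟨le_rfl, le_rfl⟩)
    linarith
  have h3 : ((Finset.univ.filter (fun v => ¬ (1 ≤ sec (bl v) ∧ bl v ≠ E (sec (bl v))))).card : ℝ)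
      ≤ (Finset.univ.filter (fun v => sec (bl v) = 0)).card +
      ((Finset.range Q).biUnion (fun q => Finset.univ.filter (fun v => bl v = E q))).card := by
    exact_mod_cast (Finset.card_le_card hsub).trans (Finset.card_union_le _ _)
  linarith

open Classical in
/-- vertices close to one of a family of intervals -/
lemma cnt_near {n : ℕ} (L : Equiv.Perm (Fin n)) (Z : Finset ℕ) (lo w : ℝ) (hlo : 0 ≤ lo)
    (hw : 0 ≤ w) (pos : ℕ → ℝ) (A : Finset (Fin n))
    (hA : ∀ v ∈ A, ∃ b ∈ Z, pos b - lo < ((L v : ℕ) : ℝ) + 1 ∧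
      ((L v : ℕ) : ℝ) + 1 ≤ pos b + w) :
    (A.card : ℝ) ≤ Z.card * (w + lo + 1) := by
  have hsub : A ⊆ Z.biUnion (fun b => Finset.univ.filter (fun v =>
      pos b - lo < ((L v : ℕ) : ℝ) + 1 ∧ ((L v : ℕ) : ℝ) + 1 ≤ pos b + w)) := by
    intro v hv
    obtain ⟨b, hb, h⟩ := hA v hv
    simp only [Finset.mem_biUnion, Finset.mem_filter, Finset.mem_univ, true_and]
    exact ⟨b, hb, h⟩
  have h1 : (A.card : ℝ) ≤ ∑ b ∈ Z, ((Finset.univ.filter (fun v =>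
      pos b - lo < ((L v : ℕ) : ℝ) + 1 ∧ ((L v : ℕ) : ℝ) + 1 ≤ pos b + w)).card : ℝ) := by
    exact_mod_cast (Finset.card_le_card hsub).trans Finset.card_biUnion_le
  refine h1.trans ((Finset.sum_le_card_nsmul _ _ (w + lo + 1) ?_).trans (by rw [nsmul_eq_mul]))
  intro b _
  have := label_le L (pos b - lo) (pos b + w) (by linarith) (Finset.univ.filter (fun v =>
      pos b - lo < ((L v : ℕ) : ℝ) + 1 ∧ ((L v : ℕ) : ℝ) + 1 ≤ pos b + w)) (by
    intro v hv
    simpa only [Finset.mem_filter, Finset.mem_univ, true_and] using hv)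
  linarith

/-- position of a vertex in terms of its section -/
lemma sec_pos {n : ℕ} (L : Equiv.Perm (Fin n)) (bl : Fin n → ℕ) (w : ℝ) (hw : 0 < w)
    (hbl : ∀ v, (bl v : ℝ) * w < ((L v : ℕ) : ℝ) + 1 ∧ ((L v : ℕ) : ℝ) + 1 ≤ ((bl v : ℝ) + 1) * w)
    (T1 l : ℕ) (E sec : ℕ → ℕ)
    (hE : ∀ q, T1 + q * l ≤ E (q + 1) ∧ E (q + 1) ≤ T1 + q * l + 3)
    (hsec : ∀ b, E (sec b) ≤ b ∧ b < E (sec b + 1)) (v : Fin n) :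
    (sec (bl v) : ℝ) * (l * w) - l * w < ((L v : ℕ) : ℝ) + 1 ∧
    ((L v : ℕ) : ℝ) + 1 ≤ (sec (bl v) : ℝ) * (l * w) + (T1 + 3) * w := by
  have h1 := hsec (bl v)
  have h2 := hbl v
  generalize sec (bl v) = q at *
  have hq : q * l ≤ bl v + l := by
    rcases q with _ | q
    · simp
    · have := hE q
      rw [add_mul, one_mul]; omega
  have hq' : bl v + 1 ≤ q * l + (T1 + 3) := by
    have := hE q
    omega
  have g1 : (q : ℝ) * l ≤ bl v + l := by exact_mod_cast hq
  have g2 : (bl v : ℝ) + 1 ≤ q * l + (T1 + 3) := by exact_mod_cast hq'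
  have k1 := mul_le_mul_of_nonneg_right g1 hw.le
  have k2 := mul_le_mul_of_nonneg_right g2 hw.le
  constructor <;> linarith

lemma idx_unique (r : ℕ) (S : ℕ → ℝ) (hS : ∀ i j, i ≤ j → j ≤ r → S i ≤ S j)
    (ℓ : ℝ) (idx : ℕ → ℕ) (h1 : ∀ q : ℕ, idx q < r) (h2 : ∀ q : ℕ, S (idx q) ≤ q * ℓ)
    (h3 : ∀ q : ℕ, idx q + 1 < r → q * ℓ < S (idx q + 1)) (q i : ℕ) (hi : i < r)
    (g1 : S i ≤ q * ℓ) (g2 : q * ℓ < S (i + 1)) : idx q = i := by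
  rcases lt_trichotomy (idx q) i with h | h | h
  · have := h3 q (by omega)
    have := hS (idx q + 1) i (by omega) (by omega)
    linarith
  · exact h
  · have := h2 q
    have := hS (i + 1) (idx q) (by omega) (h1 q).le
    linarith

open Classical in
lemma cnt_Y {n : ℕ} (L : Equiv.Perm (Fin n)) (sv : Fin n → ℕ) (ℓ Δ : ℝ) (hΔ : 0 ≤ Δ)
    (hpos : ∀ v, (sv v : ℝ) * ℓ - Δ < ((L v : ℕ) : ℝ) + 1 ∧
      ((L v : ℕ) : ℝ) + 1 ≤ (sv v : ℝ) * ℓ + Δ)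
    (r : ℕ) (S : ℕ → ℝ) (hS0 : S 0 = 0) (hSr : S r = n) (hS : ∀ i j, i ≤ j → j ≤ r → S i ≤ S j)
    (idx : ℕ → ℕ) (h1 : ∀ q : ℕ, idx q < r) (h2 : ∀ q : ℕ, S (idx q) ≤ q * ℓ)
    (h3 : ∀ q : ℕ, idx q + 1 < r → q * ℓ < S (idx q + 1)) (i : ℕ) (hi : i < r) :
    S (i + 1) - S i - 2 * Δ - 1 ≤ ((Finset.univ.filter (fun v => idx (sv v) = i)).card : ℝ) ∧
    ((Finset.univ.filter (fun v => idx (sv v) = i)).card : ℝ) ≤ S (i + 1) - S i + 2 * Δ + 1 := by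
  have hSi := hS i (i + 1) (by omega) (by omega)
  have hSi0 := hS 0 i (by omega) (by omega)
  have hSin := hS (i + 1) r (by omega) le_rfl
  constructor
  · have := label_ge L (S i + Δ) (S (i + 1) - Δ) (by linarith) (by linarith)
      (Finset.univ.filter (fun v => idx (sv v) = i)) (by
        intro v g1 g2
        simp only [Finset.mem_filter, Finset.mem_univ, true_and]
        have := hpos v
        exact idx_unique r S hS ℓ idx h1 h2 h3 _ _ hi (by linarith) (by linarith))
    linarith
  · have := label_le L (S i - Δ) (S (i + 1) + Δ) (by linarith)
      (Finset.univ.filter (fun v => idx (sv v) = i)) (by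
        intro v hv
        simp only [Finset.mem_filter, Finset.mem_univ, true_and] at hv
        have h4 := hpos v
        have h5 := h2 (sv v)
        have h6 := h3 (sv v)
        rw [hv] at h5 h6
        refine ⟨by linarith, ?_⟩
        by_cases hr : i + 1 < r
        · linarith [h6 hr]
        · have : i + 1 = r := by omega
          rw [this, hSr]
          have : (L v : ℕ) + 1 ≤ n := (L v).2
          have : ((L v : ℕ) : ℝ) + 1 ≤ n := by exact_mod_cast this
          linarith)
    linarith

lemma N_exist (ℓ Δ s t : ℝ) (hℓ : 0 < ℓ) (hs : 0 ≤ s) :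
    ∃ N : Finset ℕ, (∀ q ∈ N, 1 ≤ q ∧ s ≤ q * ℓ ∧ q * ℓ < t - Δ) ∧
      (t - Δ - s) / ℓ - 2 ≤ (N.card : ℝ) := by
  refine ⟨Finset.Ico (⌈s / ℓ⌉₊ + 1) ⌈(t - Δ) / ℓ⌉₊, ?_, ?_⟩
  · intro q hq
    rw [Finset.mem_Ico] at hq
    refine ⟨by omega, ?_, ?_⟩
    · rw [← div_le_iff₀ hℓ]
      refine (Nat.le_ceil _).trans ?_
      exact_mod_cast (by omega : ⌈s / ℓ⌉₊ ≤ q)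
    · rw [← lt_div_iff₀ hℓ]
      exact Nat.lt_ceil.mp hq.2
  · rw [Nat.card_Ico]
    have h1 : (⌈(t - Δ) / ℓ⌉₊ : ℝ) ≤ ((⌈(t - Δ) / ℓ⌉₊ - (⌈s / ℓ⌉₊ + 1) : ℕ) : ℝ)
        + (⌈s / ℓ⌉₊ + 1) := by
      exact_mod_cast (by omega : ⌈(t - Δ) / ℓ⌉₊ ≤ (⌈(t - Δ) / ℓ⌉₊ - (⌈s / ℓ⌉₊ + 1))
        + (⌈s / ℓ⌉₊ + 1))
    have h2 := Nat.le_ceil ((t - Δ) / ℓ)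
    have h3 := Nat.ceil_lt_add_one (a := s / ℓ) (by positivity)
    rw [sub_div]
    linarith

lemma card_filt_le {α : Type*} [Fintype α] (p q : α → Prop) {_ : DecidablePred p} {_ : DecidablePred q}
    (h : ∀ v, p v → q v) :
    ((Finset.univ.filter p).card : ℝ) ≤ ((Finset.univ.filter q).card : ℝ) := by
  refine Nat.cast_le.mpr (Finset.card_le_card fun v hv => ?_)
  simp only [Finset.mem_filter, Finset.mem_univ, true_and] at hv ⊢
  exact h v hv

open Classical in
lemma low_sec {n D : ℕ} (hD : 1 ≤ D) (H : SimpleGraph (Fin n)) (hH : DegeneracyLe H D)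
    (L : Equiv.Perm (Fin n)) (h : ℝ) (hh : 1 ≤ h)
    (hL : ∀ u v, H.Adj u v → |((L u : ℕ) : ℝ) - ((L v : ℕ) : ℝ)| ≤ h)
    (bl : Fin n → ℕ) (w : ℝ) (hw : 0 < w)
    (hbl : ∀ v, (bl v : ℝ) * w < ((L v : ℕ) : ℝ) + 1 ∧ ((L v : ℕ) : ℝ) + 1 ≤ ((bl v : ℝ) + 1) * w)
    (T1 l : ℕ) (hl : 5 ≤ l) (E sec : ℕ → ℕ) (hmono : StrictMono E)
    (hE : ∀ q, T1 + q * l ≤ E (q + 1) ∧ E (q + 1) ≤ T1 + q * l + 3)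
    (hsec : ∀ b, E (sec b) ≤ b ∧ b < E (sec b + 1)) (p : ℕ)
    (hp : (E (p + 2) : ℝ) * w ≤ n) :
    ((l : ℝ) - 4) * w - 9 * D * h ≤ (2 * D + 1) *
      ((Finset.univ.filter (fun v => ((1 ≤ sec (bl v) ∧ bl v ≠ E (sec (bl v))) ∧
      sec (bl v) = p + 1) ∧ degV H v ≤ 2 * D)).card : ℝ) := by
  set A := Finset.univ.filter (fun v => (1 ≤ sec (bl v) ∧ bl v ≠ E (sec (bl v))) ∧
      sec (bl v) = p + 1) with hA
  set α : ℝ := ((E (p + 1) : ℝ) + 1) * w with hα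
  set γ : ℝ := (E (p + 2) : ℝ) * w with hγ
  have hE1 := hE p
  have hE2 := hE (p + 1)
  rw [add_mul, one_mul] at hE2
  have hEE : E (p + 1) + 1 + (l - 4) ≤ E (p + 2) := by
    show _ ≤ E (p + 1 + 1)
    omega
  have hEE' : (E (p + 1) : ℝ) + 1 + (l - 4) ≤ E (p + 2) := by
    have : ((E (p + 1) + 1 + (l - 4) : ℕ) : ℝ) ≤ E (p + 2) := by exact_mod_cast hEE
    rw [Nat.cast_add, Nat.cast_sub (by omega)] at this
    push_cast at this
    exact this
  have hαγ : ((l : ℝ) - 4) * w ≤ γ - α := by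
    have := mul_le_mul_of_nonneg_right hEE' hw.le
    rw [hα, hγ]; linarith
  have hl4 : (0 : ℝ) ≤ ((l : ℝ) - 4) * w := by
    have : (5 : ℝ) ≤ l := by exact_mod_cast hl
    apply mul_nonneg <;> linarith
  have hα0 : 0 ≤ α := by positivity
  have hAge : γ - α - 1 ≤ (A.card : ℝ) := by
    apply label_ge L α γ hα0 hp A
    intro v g1 g2
    have hb := hbl v
    have c1 : E (p + 1) + 1 < bl v + 1 :=
      lt_of_mul_lt' hw (x := ((L v : ℕ) : ℝ) + 1) (by push_cast; exact g1)
        (by push_cast; exact hb.2)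
    have c2 : bl v < E (p + 2) := lt_of_mul_lt' hw hb.1 g2
    have c3 : sec (bl v) = p + 1 := sec_unique E sec hmono hsec _ _ (by omega) c2
    simp only [hA, Finset.mem_filter, Finset.mem_univ, true_and]
    rw [c3]
    omega
  set A' := Finset.univ.filter (fun v => α - h < ((L v : ℕ) : ℝ) + 1 ∧
    ((L v : ℕ) : ℝ) + 1 ≤ γ + h) with hA'
  have hA'le : (A'.card : ℝ) ≤ (γ + h) - (α - h) + 1 := by
    apply label_le L _ _ (by linarith)
    intro v hv
    simpa only [hA', Finset.mem_filter, Finset.mem_univ, true_and] using hv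
  have hAl : ∀ v ∈ A, α < ((L v : ℕ) : ℝ) + 1 ∧ ((L v : ℕ) : ℝ) + 1 ≤ γ := by
    intro v hv
    simp only [hA, Finset.mem_filter, Finset.mem_univ, true_and] at hv
    have hs := hsec (bl v)
    obtain ⟨⟨v1, v2⟩, v3⟩ := hv
    rw [v3] at hs v2
    have hb := hbl v
    have c1 : (E (p + 1) : ℝ) + 1 ≤ bl v := by exact_mod_cast (by omega : E (p + 1) + 1 ≤ bl v)
    have c2 : (bl v : ℝ) + 1 ≤ E (p + 2) := by exact_mod_cast hs.2
    have d1 := mul_le_mul_of_nonneg_right c1 hw.le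
    have d2 := mul_le_mul_of_nonneg_right c2 hw.le
    constructor
    · rw [hα]; linarith
    · rw [hγ]; linarith
  have hlow := low_count H D hH A A' (by
      intro v hv
      have := hAl v hv
      simp only [hA', Finset.mem_filter, Finset.mem_univ, true_and]
      constructor <;> linarith) (by
      intro v hv y hy
      have := hAl v hv
      have h2 := abs_le.mp (hL v y hy)
      simp only [hA', Finset.mem_filter, Finset.mem_univ, true_and]
      constructor <;> linarith)
  have hlow' : (2 * (D : ℝ) + 1) * A.card ≤
      (2 * D + 1) * (A.filter (fun v => degV H v ≤ 2 * D)).card + 2 * D * A'.card := by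
    exact_mod_cast hlow
  have hfe : (A.filter (fun v => degV H v ≤ 2 * D)) =
    (Finset.univ.filter (fun v => ((1 ≤ sec (bl v) ∧ bl v ≠ E (sec (bl v))) ∧
      sec (bl v) = p + 1) ∧ degV H v ≤ 2 * D)) := by
    rw [hA, Finset.filter_filter]
  rw [hfe] at hlow'
  have hDR : (1 : ℝ) ≤ D := by exact_mod_cast hD
  have e1 := mul_le_mul_of_nonneg_left hAge (by positivity : (0 : ℝ) ≤ 2 * D + 1)
  have e2 := mul_le_mul_of_nonneg_left hA'le (by positivity : (0 : ℝ) ≤ 2 * D)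
  have e3 : (D : ℝ) ≤ D * h := by nlinarith
  nlinarith

set_option maxHeartbeats 2000000 in
open Classical in
lemma construct (D k r n : ℕ) (hD : 1 ≤ D) (hk : 1 ≤ k) (hr : 1 ≤ r) (h w : ℝ) (hh : 1 ≤ h)
    (hw : w = 4 * k * h)
    (H : SimpleGraph (Fin n)) (hH : DegeneracyLe H D) (L : Equiv.Perm (Fin n))
    (hL : ∀ u v, H.Adj u v → |((L u : ℕ) : ℝ) - ((L v : ℕ) : ℝ)| ≤ h)
    (σ : Fin n → Fin (k + 1)) (hσ : ∀ u v, H.Adj u v → σ u ≠ σ v)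
    (s : ℝ) (hs : 10 ≤ s)
    (hzf : ∀ a b : ℕ, a < b →
      (∃ v, σ v = 0 ∧ (a : ℝ) * w < ((L v : ℕ) : ℝ) + 1 ∧ ((L v : ℕ) : ℝ) + 1 ≤ ((a : ℝ) + 1) * w) →
      (∃ v, σ v = 0 ∧ (b : ℝ) * w < ((L v : ℕ) : ℝ) + 1 ∧ ((L v : ℕ) : ℝ) + 1 ≤ ((b : ℝ) + 1) * w) →
      s ≤ (b : ℝ) - a)
    (pre : ℝ) (hpre : ∀ v, ((L v : ℕ) : ℝ) + 1 ≤ pre → σ v ≠ 0)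
    (R : SimpleGraph (Fin r × Fin k)) (hR : Bgraph r k ≤ R)
    (hz : ∀ i : Fin r, ∃ z : Fin r × Fin k, z.1 ≠ i ∧ ∀ j : Fin k, R.Adj z (i, j))
    (T1 l Q b0 : ℕ) (hT1 : 2 ≤ T1) (hl : 5 ≤ l) (hpreT : pre ≤ T1 * w)
    (S : ℕ → ℝ) (hS0 : S 0 = 0) (hSr : S r = n)
    (hS : ∀ i, i < r → S i + l * w ≤ S (i + 1))
    (hQ : (n : ℝ) + l * w ≤ Q * (l * w))
    (hb0 : 2 * (2 * (D : ℝ) + 1) * b0 ≤ ((l : ℝ) - 4) * w - 9 * D * h)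
    (Δ G Zc Wc amax : ℝ) (hΔ : Δ = (T1 + l + 3) * w)
    (hG : G = (T1 + 3) * w + 1 + Q * (w + 1)) (hZc : Zc = 1 + n / w / s)
    (hWc : Wc = Zc * (w + 2 * h + 1)) (hamax : amax = (l + 3) * w + 1) :
    ∃ (f : Fin n → Fin r × Fin k) (X : Finset (Fin n)),
      (∀ (i : Fin r) (j : Fin k),
        (S (i + 1) - S i - 2 * Δ - 1 - G - Wc) / k - 2 * r * k * amax ≤
          ((Finset.univ.filter (fun v => f v = (i, j))).card : ℝ) ∧
        ((Finset.univ.filter (fun v => f v = (i, j))).card : ℝ) ≤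
          (S (i + 1) - S i + 2 * Δ + 1) / k + 2 * r * k * amax + G + Wc ∧
        b0 * ((S (i + 1) - Δ - S i) / (l * w) - 2) / k - 2 * r * k * b0 ≤
          ((Finset.univ.filter (fun v => f v = (i, j) ∧ degV H v ≤ 2 * D)).card : ℝ)) ∧
      ((X.card : ℝ) ≤ (Zc + Q) * (3 * w + 1)) ∧
      (∀ u v, H.Adj u v → R.Adj (f u) (f v)) ∧
      (∀ x, x ∉ X → ∀ y z, H.Adj x y → H.Adj y z →
        (f y).1 = (f x).1 ∧ (f z).1 = (f x).1) ∧
      (∀ x, ((L x : ℕ) : ℝ) + 1 ≤ pre →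
        ((f x).1 : ℕ) = 0 ∧ ((f x).2 : ℕ) + 1 = (σ x : ℕ)) := by
  have : NeZero k := ⟨by omega⟩
  have hkR : (1 : ℝ) ≤ k := by exact_mod_cast hk
  have hw0 : 0 < w := by rw [hw]; positivity
  have hlR : (5 : ℝ) ≤ l := by exact_mod_cast hl
  have hℓ : 0 < (l : ℝ) * w := by positivity
  obtain ⟨u, hu⟩ := u_exist L h (by linarith)
  set bl : Fin n → ℕ := fun v => u v / (4 * k) with hbldef
  have hbl : ∀ v, (bl v : ℝ) * w < ((L v : ℕ) : ℝ) + 1 ∧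
      ((L v : ℕ) : ℝ) + 1 ≤ ((bl v : ℝ) + 1) * w := by
    intro v
    rw [hw]
    exact bl_bd hk h _ (by linarith) (hu v).1 (hu v).2
  have hLn : ∀ v, ((L v : ℕ) : ℝ) + 1 ≤ n := fun v => by
    have : (L v : ℕ) + 1 ≤ n := (L v).2
    exact_mod_cast this
  have huadj : ∀ x y, H.Adj x y → u x ≤ u y + 1 := by
    intro x y hxy
    have h1 := abs_le.mp (hL x y hxy)
    have h2 := hu x
    have h3 := hu y
    have : u x < u y + 2 := by
      apply lt_of_mul_lt' (w := h) (x := ((L x : ℕ) : ℝ) + 1) (by linarith) h2.1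
      push_cast
      linarith
    omega
  let Zf : ℕ → Prop := fun x => ∃ v, σ v = 0 ∧ u v = x
  let ZB : ℕ → Prop := fun b => ∃ v, σ v = 0 ∧ bl v = b
  have hZfB : ∀ x, Zf x → ZB (x / (4 * k)) := by
    rintro x ⟨v, h1, rfl⟩; exact ⟨v, h1, rfl⟩
  have hZBs : ∀ a b, a < b → ZB a → ZB b → s ≤ (b : ℝ) - a := by
    rintro a b hab ⟨v, v1, rfl⟩ ⟨v', v1', rfl⟩
    exact hzf _ _ hab ⟨v, v1, hbl v⟩ ⟨v', v1', hbl v'⟩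
  have hZB : ∀ a b, a < b → ZB a → ZB b → a + 10 ≤ b := by
    intro a b hab ha hb
    have := hZBs a b hab ha hb
    have : (a : ℝ) + 10 ≤ b := by linarith
    exact_mod_cast this
  obtain ⟨E, hE0, hE, hEfree⟩ := sections_exist ZB hZB T1 l
  have hE2 : ∀ q, E q + 2 ≤ E (q + 1) := by
    intro q
    rcases q with _ | q
    · have := hE 0; omega
    · have h1 := hE q
      have h2 := hE (q + 1)
      rw [add_mul, one_mul] at h2
      omega
  have hmono : StrictMono E := strictMono_nat_of_lt_succ fun q => by have := hE2 q; omega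
  obtain ⟨sec, hsec⟩ := sec_exist E hE0 hmono
  have hfree : ∀ q x, x / (4 * k) ≤ E (q + 1) + 1 → E (q + 1) ≤ x / (4 * k) + 1 → ¬ Zf x :=
    fun q x h1 h2 h3 => hEfree q _ h1 h2 (hZfB x h3)
  obtain ⟨idx, hi0, his, hir, hi1, hi2⟩ := idx_exist r hr S (l * w) hℓ hS0 hS
  let idf : ℕ → Fin r := fun q => ⟨idx q, hir q⟩
  have hidf : ∀ q, (idf (q + 1) : ℕ) = idf q + 1 ∨ (idf (q + 1) : ℕ) = idf q := fun q =>
    (his q).symm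
  have hSstep : ∀ i, i < r → S i ≤ S (i + 1) := fun i hi => by linarith [hS i hi]
  have hSmono : ∀ i j, i ≤ j → j ≤ r → S i ≤ S j := by
    intro i j hij
    induction j, hij using Nat.le_induction with
    | base => intro _; exact le_rfl
    | succ j _ ih => intro hj; exact (ih (by omega)).trans (hSstep j (by omega))
  choose z hz1 hz2 using hz
  -- positions
  have hpos0 := sec_pos L bl w hw0 hbl T1 l E sec hE hsec
  have hpos : ∀ v, ((sec (bl v) : ℕ) : ℝ) * (l * w) - Δ < ((L v : ℕ) : ℝ) + 1 ∧
      ((L v : ℕ) : ℝ) + 1 ≤ ((sec (bl v) : ℕ) : ℝ) * (l * w) + Δ := by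
    intro v
    have := hpos0 v
    have t : (0 : ℝ) ≤ T1 * w := by positivity
    have hΔ' : Δ = T1 * w + l * w + 3 * w := by rw [hΔ]; ring
    constructor <;> linarith
  have hsQ : ∀ v, sec (bl v) < Q := by
    intro v
    have h1 := (hpos0 v).1
    have h2 := hLn v
    have : ((sec (bl v) : ℕ) : ℝ) * (l * w) < Q * (l * w) := by linarith
    exact_mod_cast lt_of_mul_lt_mul_right this hℓ.le
  have hQ0 : 0 < Q := by
    rcases Nat.eq_zero_or_pos Q with h0 | h0
    · rw [h0] at hQ
      have : (0 : ℝ) ≤ n := Nat.cast_nonneg _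
      simp only [Nat.cast_zero, zero_mul] at hQ
      linarith
    · exact h0
  -- the core
  obtain ⟨core, hcore⟩ : ∃ core : Fin n → Prop, ∀ v, core v ↔
    (1 ≤ sec (bl v) ∧ bl v ≠ E (sec (bl v))) := ⟨_, fun _ => Iff.rfl⟩
  obtain ⟨cq1, hcq1⟩ := cq_exist hk σ (fun q v => (core v ∧ sec (bl v) = q) ∧ degV H v ≤ 2 * D ∧
    Wset Zf (u v))
  let cq : ℕ → Fin (k + 1) := fun q => if q = 0 then 0 else cq1 q
  have hcq0 : ∀ q, ccol Zf cq 0 q = 0 := by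
    intro q
    unfold ccol
    split_ifs
    · simp only [cq, if_true]
    · rfl
  have hcqs : ∀ p, cq (p + 1) = cq1 (p + 1) := fun p => if_neg (by omega)
  let virt : Fin n → Option (Fin k) := fun v =>
    kap hk (ccol Zf cq (sec (bl v)) (u v)) (Equiv.refl _) (σ v)
  have hvirt : ∀ v, virt v = none → Wset Zf (u v) ∧ σ v = cq (sec (bl v)) := by
    intro v hv
    have h1 : σ v = ccol Zf cq (sec (bl v)) (u v) := by
      by_contra hne
      simp only [virt, kap, if_neg hne] at hv
      split_ifs at hv
    by_cases hW : Wset Zf (u v)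
    · refine ⟨hW, ?_⟩
      rw [h1, ccol, if_pos hW]
    · rw [ccol, if_neg hW] at h1
      exact absurd (Or.inr (Or.inl ⟨v, h1, rfl⟩)) hW
  obtain ⟨τ, hτ⟩ := balance (r := r) (fun v => sec (bl v)) hsQ hQ0 core
    (fun v => degV H v ≤ 2 * D) virt idf z amax b0 (by
      intro q
      rw [hamax]
      refine le_trans (card_filt_le _ _ ?_) (cnt_amax L bl w hw0 hbl T1 l E sec hE hsec q)
      intro v hv
      exact ⟨(hcore v).mp hv.1, hv.2⟩)
  let π : ℕ → Equiv.Perm (Fin k) := fun q => if q = 0 then Equiv.refl _ else Equiv.addRight (τ q)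
  have hwalk := fun q => walk (π q) (π (q + 1))
  choose ω hω0 hω1 hωinj hωs using hwalk
  let f : Fin n → Fin r × Fin k := fun v =>
    plc z (idf (sec (bl v))) (stt hk Zf E sec cq π ω (u v) (σ v))
  have hfcore : ∀ v, core v →
      f v = plc z (idf (sec (bl v))) ((virt v).map (fun c => c + τ (sec (bl v)))) := by
    intro v hv
    rw [hcore] at hv
    have e1 : stt hk Zf E sec cq π ω (u v) (σ v) = kap hk (ccol Zf cq (sec (bl v)) (u v))
        (π (sec (bl v))) (σ v) := by
      unfold stt
      rw [if_neg (fun hc => hv.2 hc.2)]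
    have e2 : (π (sec (bl v)) : Fin k → Fin k) = fun c => c + τ (sec (bl v)) := by
      simp only [π]
      rw [if_neg (by omega)]
      rfl
    show plc z (idf (sec (bl v))) (stt hk Zf E sec cq π ω (u v) (σ v)) = _
    rw [e1, kap_map, e2]
  have hbal := hτ f hfcore
  -- zero blocks
  let Z : Finset ℕ := (Finset.univ.filter (fun v => σ v = 0)).image bl
  have hZmem : ∀ b, ZB b → b ∈ Z := by
    rintro b ⟨v, v1, v2⟩
    simp only [Z, Finset.mem_image, Finset.mem_filter, Finset.mem_univ, true_and]
    exact ⟨v, v1, v2⟩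
  have hZmem' : ∀ b ∈ Z, ZB b := by
    intro b hb
    simp only [Z, Finset.mem_image, Finset.mem_filter, Finset.mem_univ, true_and] at hb
    exact hb
  have hZcard : (Z.card : ℝ) ≤ Zc := by
    rw [hZc]
    apply spaced_card Z s (n / w) (by linarith) (by positivity)
    · intro a ha b hb hab
      exact hZBs a b hab (hZmem' a ha) (hZmem' b hb)
    · intro b hb
      obtain ⟨v, _, rfl⟩ := hZmem' b hb
      rw [le_div_iff₀ hw0]
      linarith [(hbl v).1, hLn v]
  have hnoncore : ((Finset.univ.filter (fun v => ¬ core v)).card : ℝ) ≤ G := by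
    rw [hG]
    refine le_trans (card_filt_le _ _ ?_) (cnt_noncore L bl w hw0 hbl T1 l Q E sec hE hsec hsQ)
    intro v hv
    rwa [hcore] at hv
  have hWcard : ((Finset.univ.filter (fun v => core v ∧ virt v = none)).card : ℝ) ≤ Wc := by
    have := cnt_near L Z h (w + h) (by linarith) (by linarith) (fun b => (b : ℝ) * w)
      (Finset.univ.filter (fun v => core v ∧ virt v = none)) (by
        intro v hv
        simp only [Finset.mem_filter, Finset.mem_univ, true_and] at hv
        have hW := (hvirt v hv.2).1
        have hx : ∃ x, Zf x ∧ u v ≤ x + 1 ∧ x ≤ u v + 1 := by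
          rcases hW with g | g | g
          · exact ⟨_, g, by omega, by omega⟩
          · exact ⟨_, g, by omega, by omega⟩
          · exact ⟨_, g, by omega, by omega⟩
        obtain ⟨x, ⟨y, y1, rfl⟩, x2, x3⟩ := hx
        refine ⟨bl y, hZmem _ ⟨y, y1, rfl⟩, ?_⟩
        have a1 : (u v : ℝ) ≤ u y + 1 := by exact_mod_cast x2
        have a2 : (u y : ℝ) ≤ u v + 1 := by exact_mod_cast x3
        have b1 := mul_le_mul_of_nonneg_right a1 (by linarith : (0 : ℝ) ≤ h)
        have b2 := mul_le_mul_of_nonneg_right a2 (by linarith : (0 : ℝ) ≤ h)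
        have c1 : bl y * (4 * k) ≤ u y := Nat.div_mul_le_self _ _
        have c2 : u y + 1 ≤ (bl y + 1) * (4 * k) := by
          have := Nat.lt_div_mul_add (a := u y) (b := 4 * k) (by omega)
          rw [add_mul, one_mul]; exact this
        have c1' : (bl y : ℝ) * (4 * k) ≤ u y := by exact_mod_cast c1
        have c2' : (u y : ℝ) + 1 ≤ ((bl y : ℝ) + 1) * (4 * k) := by exact_mod_cast c2
        have d1 := mul_le_mul_of_nonneg_right c1' (by linarith : (0 : ℝ) ≤ h)
        have d2 := mul_le_mul_of_nonneg_right c2' (by linarith : (0 : ℝ) ≤ h)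
        have hv' := hu v
        rw [hw]
        constructor <;> linarith)
    have h2 : (Z.card : ℝ) * (w + h + h + 1) ≤ Zc * (w + h + h + 1) :=
      mul_le_mul_of_nonneg_right hZcard (by linarith)
    rw [hWc]
    linarith
  -- low vertices
  have hlow : ∀ q, 1 ≤ q → (E (q + 1) : ℝ) * w ≤ n → b0 ≤
      (Finset.univ.filter (fun v => core v ∧ sec (bl v) = q ∧ degV H v ≤ 2 * D ∧
        virt v ≠ none)).card := by
    intro q hq hEq
    obtain ⟨p, rfl⟩ : ∃ p, q = p + 1 := ⟨q - 1, by omega⟩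
    have h1 := low_sec hD H hH L h hh hL bl w hw0 hbl T1 l hl E sec hmono hE hsec p hEq
    have h2 := (Nat.cast_le (α := ℝ)).mpr (hcq1 (p + 1))
    rw [← hcqs] at h2
    push_cast at h2
    have h2' : 2 * ((Finset.univ.filter (fun v => ((core v ∧ sec (bl v) = p + 1) ∧
        degV H v ≤ 2 * D ∧ Wset Zf (u v)) ∧ σ v = cq (p + 1))).card : ℝ) ≤
      ((Finset.univ.filter (fun v => (core v ∧ sec (bl v) = p + 1) ∧
        degV H v ≤ 2 * D ∧ Wset Zf (u v))).card : ℝ) :=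
      le_trans (mul_le_mul_of_nonneg_left (card_filt_le _ _ (fun v hv => hv)) (by norm_num))
        (h2.trans (card_filt_le _ _ (fun v hv => hv)))
    have h3 : ((Finset.univ.filter (fun v => (core v ∧ sec (bl v) = p + 1) ∧
        degV H v ≤ 2 * D ∧ Wset Zf (u v))).card : ℝ) ≤
        (Finset.univ.filter (fun v => (core v ∧ sec (bl v) = p + 1) ∧ degV H v ≤ 2 * D)).card :=
      card_filt_le _ _ (fun v hv => ⟨hv.1, hv.2.1⟩)
    have h4 : ((Finset.univ.filter (fun v => (core v ∧ sec (bl v) = p + 1) ∧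
        degV H v ≤ 2 * D)).card : ℝ) ≤
        (Finset.univ.filter (fun v => core v ∧ sec (bl v) = p + 1 ∧ degV H v ≤ 2 * D ∧
          virt v ≠ none)).card +
        (Finset.univ.filter (fun v => ((core v ∧ sec (bl v) = p + 1) ∧
        degV H v ≤ 2 * D ∧ Wset Zf (u v)) ∧ σ v = cq (p + 1))).card := by
      have : (Finset.univ.filter (fun v => (core v ∧ sec (bl v) = p + 1) ∧
        degV H v ≤ 2 * D)) ⊆
        (Finset.univ.filter (fun v => core v ∧ sec (bl v) = p + 1 ∧ degV H v ≤ 2 * D ∧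
          virt v ≠ none)) ∪
        (Finset.univ.filter (fun v => ((core v ∧ sec (bl v) = p + 1) ∧
        degV H v ≤ 2 * D ∧ Wset Zf (u v)) ∧ σ v = cq (p + 1))) := by
        intro v hv
        simp only [Finset.mem_filter, Finset.mem_univ, true_and, Finset.mem_union] at hv ⊢
        by_cases hvn : virt v = none
        · right
          obtain ⟨w1, w2⟩ := hvirt v hvn
          rw [hv.1.2] at w2
          exact ⟨⟨hv.1, hv.2, w1⟩, w2⟩
        · left
          exact ⟨hv.1.1, hv.1.2, hv.2, hvn⟩
      exact_mod_cast (Finset.card_le_card this).trans (Finset.card_union_le _ _)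
    have h5 : ((Finset.univ.filter (fun v => ((1 ≤ sec (bl v) ∧ bl v ≠ E (sec (bl v))) ∧
      sec (bl v) = p + 1) ∧ degV H v ≤ 2 * D)).card : ℝ) ≤
      ((Finset.univ.filter (fun v => (core v ∧ sec (bl v) = p + 1) ∧
        degV H v ≤ 2 * D)).card : ℝ) :=
      card_filt_le _ _ (fun v hv => ⟨⟨(hcore v).mpr hv.1.1, hv.1.2⟩, hv.2⟩)
    have h6 := mul_le_mul_of_nonneg_left (h5.trans (by linarith :
      _ ≤ 2 * ((Finset.univ.filter (fun v => core v ∧ sec (bl v) = p + 1 ∧ degV H v ≤ 2 * D ∧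
          virt v ≠ none)).card : ℝ))) (by positivity : (0 : ℝ) ≤ 2 * D + 1)
    have h7 : 2 * (2 * (D : ℝ) + 1) * b0 ≤ 2 * (2 * (D : ℝ) + 1) *
      ((Finset.univ.filter (fun v => core v ∧ sec (bl v) = p + 1 ∧ degV H v ≤ 2 * D ∧
          virt v ≠ none)).card : ℝ) := by linarith
    exact_mod_cast le_of_mul_le_mul_left h7 (by positivity)
  let X : Finset (Fin n) := Finset.univ.filter (fun v => ∃ b', b' ≤ bl v + 1 ∧ bl v ≤ b' + 1 ∧
    (ZB b' ∨ ∃ q, b' = E (q + 1)))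
  refine ⟨f, X, ?_, ?_, ?_, ?_, ?_⟩
  · intro i j
    obtain ⟨g1, g2, g3⟩ := hbal i j
    have hY := cnt_Y L (fun v => sec (bl v)) (l * w) Δ (by rw [hΔ]; positivity) hpos r S hS0 hSr
      hSmono idx hir hi1 hi2 i i.2
    have hYY : (Finset.univ.filter (fun v => idf (sec (bl v)) = i)) =
        (Finset.univ.filter (fun v => idx (sec (bl v)) = i)) := by
      ext v
      simp only [Finset.mem_filter, Finset.mem_univ, true_and, idf, Fin.ext_iff]
    have hY1 := hY.1
    have hY2 := hY.2
    rw [hYY] at g1 g2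
    refine ⟨?_, ?_, ?_⟩
    · refine le_trans ?_ (g1.trans (card_filt_le _ _ (fun v hv => hv)))
      have : (S (i + 1) - S i - 2 * Δ - 1 - G - Wc) / k ≤
        (((Finset.univ.filter (fun v => idx (sec (bl v)) = i)).card : ℝ)
            - (Finset.univ.filter (fun v => ¬ core v)).card
            - (Finset.univ.filter (fun v => core v ∧ virt v = none)).card) / k := by
        apply div_le_div_of_nonneg_right _ (by linarith)
        linarith
      linarith
    · refine (card_filt_le _ _ (fun v hv => hv)).trans (g2.trans ?_)
      have : ((Finset.univ.filter (fun v => idx (sec (bl v)) = i)).card : ℝ) / k ≤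
        (S (i + 1) - S i + 2 * Δ + 1) / k := by
        apply div_le_div_of_nonneg_right _ (by linarith)
        linarith
      linarith
    · have hSi0 : 0 ≤ S i := by rw [← hS0]; exact hSmono 0 i (by omega) i.2.le
      obtain ⟨N, hN1, hN2⟩ := N_exist (l * w) Δ (S i) (S (i + 1)) hℓ hSi0
      have hSin : S (i + 1) ≤ n := by rw [← hSr]; exact hSmono _ _ i.2 le_rfl
      have hΔ' : Δ = T1 * w + l * w + 3 * w := by rw [hΔ]; ring
      have hTw : (0 : ℝ) ≤ T1 * w := by positivity
      have g4 := g3 N (by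
        intro q hq
        obtain ⟨q1, q2, q3⟩ := hN1 q hq
        refine ⟨?_, ?_, ?_⟩
        · have : (q : ℝ) * (l * w) < Q * (l * w) := by linarith
          exact_mod_cast lt_of_mul_lt_mul_right this hℓ.le
        · exact Fin.ext (idx_unique r S hSmono _ idx hir hi1 hi2 q i i.2 q2 (by linarith))
        · refine le_trans (hlow q q1 ?_) (le_of_eq ?_)
          · have : (E (q + 1) : ℝ) ≤ T1 + q * l + 3 := by exact_mod_cast (hE q).2
            have := mul_le_mul_of_nonneg_right this hw0.le
            linarith
          · congr)
      refine le_trans ?_ (g4.trans (card_filt_le _ _ (fun v hv => hv)))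
      have : (b0 : ℝ) * ((S (i + 1) - Δ - S i) / (l * w) - 2) / k ≤ b0 * N.card / k := by
        apply div_le_div_of_nonneg_right _ (by linarith)
        exact mul_le_mul_of_nonneg_left hN2 (Nat.cast_nonneg _)
      linarith
  · -- size of X
    let X1 : Finset (Fin n) := Finset.univ.filter (fun v => ∃ b', b' ≤ bl v + 1 ∧ bl v ≤ b' + 1 ∧
      ZB b')
    let X2 : Finset (Fin n) := Finset.univ.filter (fun v => ∃ q, E (q + 1) ≤ bl v + 1 ∧
      bl v ≤ E (q + 1) + 1)
    have hnear : ∀ v (b : ℕ), b ≤ bl v + 1 → bl v ≤ b + 1 →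
        (b : ℝ) * w - w < ((L v : ℕ) : ℝ) + 1 ∧ ((L v : ℕ) : ℝ) + 1 ≤ (b : ℝ) * w + 2 * w := by
      intro v b p1 p2
      have a1 : (b : ℝ) ≤ bl v + 1 := by exact_mod_cast p1
      have a2 : (bl v : ℝ) ≤ b + 1 := by exact_mod_cast p2
      have c1 := mul_le_mul_of_nonneg_right a1 hw0.le
      have c2 := mul_le_mul_of_nonneg_right a2 hw0.le
      have := hbl v
      constructor <;> linarith
    have h1 : (X1.card : ℝ) ≤ Z.card * (2 * w + w + 1) := by
      refine cnt_near L Z w (2 * w) hw0.le (by linarith) (fun b => (b : ℝ) * w) X1 ?_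
      intro v hv
      simp only [X1, Finset.mem_filter, Finset.mem_univ, true_and] at hv
      obtain ⟨b, p1, p2, p3⟩ := hv
      exact ⟨b, hZmem b p3, hnear v b p1 p2⟩
    have h2 : (X2.card : ℝ) ≤ (Finset.range Q).card * (2 * w + w + 1) := by
      refine cnt_near L (Finset.range Q) w (2 * w) hw0.le (by linarith)
        (fun q => (E (q + 1) : ℝ) * w) X2 ?_
      intro v hv
      simp only [X2, Finset.mem_filter, Finset.mem_univ, true_and] at hv
      obtain ⟨q, p1, p2⟩ := hv
      refine ⟨q, ?_, hnear v _ p1 p2⟩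
      have h3 := hsec (bl v)
      have h4 : E (q + 1) ≤ E (sec (bl v) + 1) := by omega
      have h5 := hmono.le_iff_le.mp h4
      have h6 := hsQ v
      rw [Finset.mem_range]
      omega
    rw [Finset.card_range] at h2
    have hsub : X ⊆ X1 ∪ X2 := by
      intro v hv
      simp only [X, X1, X2, Finset.mem_filter, Finset.mem_univ, true_and, Finset.mem_union] at hv ⊢
      obtain ⟨b, p1, p2, p3 | ⟨q, rfl⟩⟩ := hv
      · exact Or.inl ⟨b, p1, p2, p3⟩
      · exact Or.inr ⟨q, p1, p2⟩
    have h3 : (X.card : ℝ) ≤ X1.card + X2.card := by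
      exact_mod_cast (Finset.card_le_card hsub).trans (Finset.card_union_le _ _)
    have h4 : (Z.card : ℝ) * (2 * w + w + 1) ≤ Zc * (2 * w + w + 1) :=
      mul_le_mul_of_nonneg_right hZcard (by linarith)
    linarith
  · intro x y hxy
    exact H3_lem hk H σ hσ R hR z hz2 u huadj E sec cq π ω idf hidf Zf
      (fun v hv => ⟨v, hv, rfl⟩) hE2 hsec hfree hω0 hω1 hωinj hωs x y hxy
  · intro x hx y y' hxy hyz
    have hX : ∀ b', b' ≤ bl x + 1 → bl x ≤ b' + 1 → ¬ ZB b' ∧ ∀ q, b' ≠ E (q + 1) := by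
      intro b' p1 p2
      constructor
      · intro p3
        exact hx (by
          simp only [X, Finset.mem_filter, Finset.mem_univ, true_and]
          exact ⟨b', p1, p2, Or.inl p3⟩)
      · intro q p3
        exact hx (by
          simp only [X, Finset.mem_filter, Finset.mem_univ, true_and]
          exact ⟨b', p1, p2, Or.inr ⟨q, p3⟩⟩)
    have key : ∀ v, u v ≤ u x + 2 → u x ≤ u v + 2 → (f v).1 = idf (sec (bl x)) := by
      intro v p1 p2
      exact H4_lem hk z E sec cq π ω idf Zf hE0 hE2 hsec (u x) (u v) (σ v)
        (fun e => ⟨v, e, rfl⟩) p1 p2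
        (fun u' q1 q2 q3 => (hX _ q1 q2).1 (hZfB _ q3))
        (fun q q1 q2 => (hX _ q1 q2).2 q rfl)
    have a1 := huadj _ _ hxy
    have a2 := huadj _ _ hxy.symm
    have a3 := huadj _ _ hyz
    have a4 := huadj _ _ hyz.symm
    rw [key x (by omega) (by omega), key y (by omega) (by omega), key y' (by omega) (by omega)]
    exact ⟨rfl, rfl⟩
  · intro x hx
    have hb : bl x < T1 := lt_of_mul_lt' hw0 (hbl x).1 (hx.trans hpreT)
    have hs0 : sec (bl x) = 0 := sec_unique E sec hmono hsec _ _ (by omega) (by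
      have := hE 0; omega)
    have hne := hpre x hx
    have hst : stt hk Zf E sec cq π ω (u x) (σ x) = some (finPr hk (σ x)) := by
      have hs0' : sec (u x / (4 * k)) = 0 := hs0
      unfold stt
      rw [hs0', if_neg (by omega), hcq0, kap_zero hk _ _ hne]
      simp only [π, if_true, Equiv.refl_apply]
    have hfx : f x = (idf 0, finPr hk (σ x)) := by
      show plc z (idf (sec (bl x))) (stt hk Zf E sec cq π ω (u x) (σ x)) = _
      rw [hst, hs0]
      rfl
    rw [hfx]
    refine ⟨hi0, ?_⟩
    have : (σ x : ℕ) ≠ 0 := fun e => hne (Fin.ext e)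
    show (σ x : ℕ) - 1 + 1 = σ x
    omega

set_option maxHeartbeats 1000000 in
lemma nums (D k r : ℕ) (hD : 1 ≤ D) (hk : 1 ≤ k) (hr : 1 ≤ r) (ξ β N w : ℝ)
    (hξ0 : 0 < ξ) (hβ0 : 0 < β) (hξ : ξ ≤ 1 / (k * r))
    (hβ : β ≤ 1e-10 * ξ ^ 2 / ((D : ℝ) * k ^ 4 * r)) (hN : 1 ≤ β * N)
    (hw : w = 4 * k * (β * N)) :
    ∃ T1 l Q b0 : ℕ, 2 ≤ T1 ∧ 5 ≤ l ∧ Real.sqrt β * N ≤ T1 * w ∧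
      N + l * w ≤ Q * (l * w) ∧
      2 * (2 * (D : ℝ) + 1) * b0 ≤ ((l : ℝ) - 4) * w - 9 * D * (β * N) ∧
      (T1 : ℝ) * w ≤ 2e-5 * (ξ * N) ∧ (k : ℝ) * r * (l * w) ≤ 1e-4 * (ξ * N) ∧
      (Q : ℝ) * w ≤ 5e-6 * (ξ * N) ∧ (D : ℝ) * k * r * w ≤ 4e-10 * (ξ * N) ∧
      0.99 * (l * w) ≤ 6 * D * b0 := by
  have hDR : (1 : ℝ) ≤ D := by exact_mod_cast hD
  have hkR : (1 : ℝ) ≤ k := by exact_mod_cast hk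
  have hrR : (1 : ℝ) ≤ r := by exact_mod_cast hr
  have hkr1 : (1 : ℝ) ≤ k * r := by nlinarith
  have hkr0 : (0 : ℝ) < k * r := by linarith
  have hN0 : 0 < N := by
    by_contra hh
    nlinarith
  have hξ1 : ξ * (k * r) ≤ 1 := by rwa [le_div_iff₀ hkr0] at hξ
  have hξle : ξ ≤ 1 := by nlinarith
  set ε := ξ * N with hε
  have hε0 : 0 < ε := by positivity
  have hεN : ε ≤ N := by rw [hε]; nlinarith
  have hβ1 : β * ((D : ℝ) * k ^ 4 * r) ≤ 1e-10 * ξ ^ 2 := by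
    rwa [le_div_iff₀ (by positivity)] at hβ
  have hk3 : (1 : ℝ) ≤ k ^ 2 := by nlinarith
  have hw0 : 0 < w := by rw [hw]; positivity
  have hhw : β * N ≤ w / 4 := by
    rw [hw]; nlinarith
  have hw4 : 4 ≤ w := by linarith
  -- bound on w
  have hDw : (D : ℝ) * k * r * w ≤ 4e-10 * (ξ * ε) := by
    have e1 : (D : ℝ) * k * r * w * k ^ 2 = 4 * N * (β * ((D : ℝ) * k ^ 4 * r)) := by
      rw [hw]; ring
    have e2 : 4 * N * (β * ((D : ℝ) * k ^ 4 * r)) ≤ 4 * N * (1e-10 * ξ ^ 2) :=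
      mul_le_mul_of_nonneg_left hβ1 (by positivity)
    have e3 : (D : ℝ) * k * r * w ≤ (D : ℝ) * k * r * w * k ^ 2 :=
      le_mul_of_one_le_right (by positivity) hk3
    rw [hε]
    linarith
  have hDkr : (1 : ℝ) ≤ D * (k * r) := by nlinarith
  have hkrw : (k : ℝ) * r * w ≤ 4e-10 * (ξ * ε) := by
    have : (k : ℝ) * r * w ≤ D * (k * r * w) :=
      le_mul_of_one_le_left (by positivity) hDR
    linarith
  have hww : w ≤ 4e-10 * (ξ * ε) := by
    have : w ≤ (k * r) * w := le_mul_of_one_le_left (by positivity) hkr1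
    linarith
  have hξε : ξ * ε ≤ ε := mul_le_of_le_one_left hε0.le hξle
  -- l
  obtain ⟨l, hl1, hl2⟩ : ∃ l : ℕ, (l : ℝ) * w ≤ ε / (10000 * (k * r)) ∧
      ε / (10000 * (k * r)) ≤ (l : ℝ) * w + w := by
    have e1 : ε / (10000 * (k * r) * w) * w = ε / (10000 * (k * r)) := by field_simp
    refine ⟨⌊ε / (10000 * (k * r) * w)⌋₊, ?_, ?_⟩
    · have := Nat.floor_le (a := ε / (10000 * (k * r) * w)) (by positivity)
      have h2 := mul_le_mul_of_nonneg_right this hw0.le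
      rw [e1] at h2
      exact h2
    · have := (Nat.lt_floor_add_one (ε / (10000 * (k * r) * w))).le
      have h2 := mul_le_mul_of_nonneg_right this hw0.le
      rw [e1, add_mul, one_mul] at h2
      exact h2
  have hl1' : (k : ℝ) * r * (l * w) ≤ 1e-4 * ε := by
    rw [le_div_iff₀ (by positivity)] at hl1
    linarith
  have hl2' : 1e-4 * ε ≤ (k : ℝ) * r * (l * w) + k * r * w := by
    rw [div_le_iff₀ (by positivity)] at hl2
    linarith
  have hl3 : 999e-7 * ε ≤ (k : ℝ) * r * (l * w) := by linarith
  have hDwl : (D : ℝ) * w ≤ 41e-7 * (ξ * (l * w)) := by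
    have e1 : (k : ℝ) * r * (D * w) ≤ k * r * (41e-7 * (ξ * (l * w))) := by
      have := mul_le_mul_of_nonneg_left hl3 hξ0.le
      linarith
    exact le_of_mul_le_mul_left e1 hkr0
  have hlw0 : 0 < (l : ℝ) * w := by
    by_contra hh
    have : (k : ℝ) * r * (l * w) ≤ 0 := mul_nonpos_of_nonneg_of_nonpos hkr0.le (by linarith)
    linarith
  have hξl : ξ * (l * w) ≤ l * w := mul_le_of_le_one_left hlw0.le hξle
  have hwD : w ≤ D * w := le_mul_of_one_le_left hw0.le hDR
  have hl5 : 5 ≤ l := by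
    have : (5 : ℝ) * w ≤ l * w := by linarith
    exact_mod_cast le_of_mul_le_mul_right this hw0
  have hlN : (l : ℝ) * w ≤ 1e-4 * ε := by
    have : (l : ℝ) * w ≤ k * r * (l * w) := le_mul_of_one_le_left hlw0.le hkr1
    linarith
  -- sqrt
  have hsq : Real.sqrt β ≤ 1e-5 * ξ := by
    rw [Real.sqrt_le_left (by positivity)]
    have h4 : (1 : ℝ) ≤ (D : ℝ) * k ^ 4 * r := by
      have a : (1 : ℝ) ≤ k ^ 4 := one_le_pow₀ hkR
      have b : (1 : ℝ) ≤ D * k ^ 4 := by nlinarith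
      nlinarith
    have : β ≤ β * ((D : ℝ) * k ^ 4 * r) := le_mul_of_one_le_right hβ0.le h4
    nlinarith
  have hpre : Real.sqrt β * N ≤ 1e-5 * ε := by
    have := mul_le_mul_of_nonneg_right hsq hN0.le
    linarith
  have hX1 : Real.sqrt β * N ≤ (⌈Real.sqrt β * N / w⌉₊ : ℝ) * w := by
    rw [← div_le_iff₀ hw0]; exact Nat.le_ceil _
  have hX2 : (⌈Real.sqrt β * N / w⌉₊ : ℝ) * w ≤ Real.sqrt β * N + w := by
    have := (Nat.ceil_lt_add_one (a := Real.sqrt β * N / w) (by positivity)).le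
    have h2 := mul_le_mul_of_nonneg_right this hw0.le
    rw [add_mul, div_mul_cancel₀ _ hw0.ne'] at h2
    linarith
  have hQ1 : N ≤ (⌈N / (l * w)⌉₊ : ℝ) * (l * w) := by
    rw [← div_le_iff₀ hlw0]; exact Nat.le_ceil _
  have hQ2 : (⌈N / (l * w)⌉₊ : ℝ) * (l * w) ≤ N + l * w := by
    have := (Nat.ceil_lt_add_one (a := N / (l * w)) (by positivity)).le
    have h2 := mul_le_mul_of_nonneg_right this hlw0.le
    rw [add_mul, div_mul_cancel₀ _ hlw0.ne'] at h2
    linarith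
  obtain ⟨bb, hbb⟩ : ∃ bb : ℝ, bb = (((l : ℝ) - 4) * w - 9 * D * (β * N)) / (2 * (2 * D + 1)) := ⟨_, rfl⟩
  have hDh : (D : ℝ) * (β * N) ≤ D * w / 4 := by
    have := mul_le_mul_of_nonneg_left hhw (by positivity : (0 : ℝ) ≤ D)
    linarith
  have hDh1 : (D : ℝ) ≤ D * w / 4 := by nlinarith
  have hnum : 0 ≤ ((l : ℝ) - 4) * w - 9 * D * (β * N) := by linarith
  have hbb0 : 0 ≤ bb := by rw [hbb]; positivity
  refine ⟨⌈Real.sqrt β * N / w⌉₊ + 2, l, ⌈N / (l * w)⌉₊ + 1, ⌊bb⌋₊, by omega, hl5, ?_, ?_, ?_, ?_,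
    hl1', ?_, ?_, ?_⟩
  · push_cast; linarith
  · push_cast; linarith
  · have := Nat.floor_le hbb0
    have h2 := mul_le_mul_of_nonneg_right this (by positivity : (0 : ℝ) ≤ 2 * (2 * D + 1))
    have h3 : bb * (2 * (2 * D + 1)) = ((l : ℝ) - 4) * w - 9 * D * (β * N) := by
      rw [hbb]; field_simp
    linarith
  · push_cast; linarith
  · push_cast
    have hq : ((⌈N / (l * w)⌉₊ : ℝ) + 1) * (l * w) ≤ 1.001 * N := by linarith
    have hq2 : ((⌈N / (l * w)⌉₊ : ℝ) + 1) * w ≤ ((⌈N / (l * w)⌉₊ : ℝ) + 1) *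
        (41e-7 * (ξ * (l * w))) := mul_le_mul_of_nonneg_left (by linarith) (by positivity)
    have hq3 := mul_le_mul_of_nonneg_left hq hξ0.le
    linarith
  · linarith
  · have := (Nat.lt_floor_add_one bb).le
    have h2 := mul_le_mul_of_nonneg_right this (by positivity : (0 : ℝ) ≤ 2 * (2 * D + 1))
    have h3 : bb * (2 * (2 * D + 1)) = ((l : ℝ) - 4) * w - 9 * D * (β * N) := by
      rw [hbb]; field_simp
    have hf0 : (0 : ℝ) ≤ ⌊bb⌋₊ := Nat.cast_nonneg _
    have hf1 : (⌊bb⌋₊ : ℝ) * (2 * (2 * D + 1)) ≤ ⌊bb⌋₊ * (6 * D) :=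
      mul_le_mul_of_nonneg_left (by linarith) hf0
    linarith

lemma sqrt_bd (D k r : ℕ) (hD : 1 ≤ D) (hk : 1 ≤ k) (hr : 1 ≤ r) (ξ β : ℝ)
    (hξ0 : 0 < ξ) (hβ0 : 0 < β)
    (hβ : β ≤ 1e-10 * ξ ^ 2 / ((D : ℝ) * k ^ 4 * r)) : Real.sqrt β ≤ 1e-5 * ξ := by
  have hDR : (1 : ℝ) ≤ D := by exact_mod_cast hD
  have hkR : (1 : ℝ) ≤ k := by exact_mod_cast hk
  have hrR : (1 : ℝ) ≤ r := by exact_mod_cast hr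
  have hβ1 : β * ((D : ℝ) * k ^ 4 * r) ≤ 1e-10 * ξ ^ 2 := by
    rwa [le_div_iff₀ (by positivity)] at hβ
  rw [Real.sqrt_le_left (by positivity)]
  have h4 : (1 : ℝ) ≤ (D : ℝ) * k ^ 4 * r := by
    have a : (1 : ℝ) ≤ k ^ 4 := one_le_pow₀ hkR
    have b : (1 : ℝ) ≤ D * k ^ 4 := by nlinarith
    nlinarith
  have : β ≤ β * ((D : ℝ) * k ^ 4 * r) := le_mul_of_one_le_right hβ0.le h4
  nlinarith

lemma small_case (D k r : ℕ) (hD : 1 ≤ D) (hk : 1 ≤ k) (hr : 1 ≤ r) (ξ β : ℝ)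
    (hξ0 : 0 < ξ) (hβ0 : 0 < β) (hξ : ξ ≤ 1 / (k * r))
    (hβ : β ≤ 1e-10 * ξ ^ 2 / ((D : ℝ) * k ^ 4 * r))
    (n : ℕ) (hn : β * n < 1) (H : SimpleGraph (Fin n))
    (L : Equiv.Perm (Fin n))
    (hL : ∀ u v, H.Adj u v → |((L u : ℕ) : ℝ) - ((L v : ℕ) : ℝ)| ≤ β * n)
    (σ : Fin n → Fin (k + 1))
    (hpre : ∀ v, ((L v : ℕ) : ℝ) + 1 ≤ Real.sqrt β * n → σ v ≠ 0)
    (R : SimpleGraph (Fin r × Fin k))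
    (m : Fin r → Fin k → ℕ) (hm : (∑ i, ∑ j, m i j) = n)
    (hmb : ∀ i j, (n : ℝ) / (10 * k * r) ≤ (m i j : ℝ)) :
    ∃ (f : Fin n → Fin r × Fin k) (X : Finset (Fin n)),
      (∀ i j, (m i j : ℝ) - ξ * n
            ≤ ((Finset.univ.filter (fun v => f v = (i, j))).card : ℝ) ∧
          ((Finset.univ.filter (fun v => f v = (i, j))).card : ℝ) ≤ (m i j : ℝ) + ξ * n) ∧
      ((X.card : ℝ) ≤ ξ * n) ∧
      (∀ u v, H.Adj u v → R.Adj (f u) (f v)) ∧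
      (∀ x, x ∉ X → ∀ y z, H.Adj x y → H.Adj y z →
        (f y).1 = (f x).1 ∧ (f z).1 = (f x).1) ∧
      (∀ x, ((L x : ℕ) : ℝ) + 1 ≤ Real.sqrt β * n →
        ((f x).1 : ℕ) = 0 ∧ ((f x).2 : ℕ) + 1 = (σ x : ℕ)) ∧
      (∀ i j, ((Finset.univ.filter (fun v => f v = (i, j))).card : ℝ) / (24 * D)
          ≤ ((Finset.univ.filter
              (fun v => f v = (i, j) ∧ degV H v ≤ 2 * D)).card : ℝ)) := by
  classical
  have hDR : (1 : ℝ) ≤ D := by exact_mod_cast hD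
  have hkR : (1 : ℝ) ≤ k := by exact_mod_cast hk
  have hrR : (1 : ℝ) ≤ r := by exact_mod_cast hr
  have hkr0 : (0 : ℝ) < k * r := by positivity
  have hn0 : (0 : ℝ) ≤ n := Nat.cast_nonneg _
  have hξn : 0 ≤ ξ * n := by positivity
  have hno : ∀ u v, ¬ H.Adj u v := by
    intro u v huv
    have h1 := (hL u v huv).trans_lt hn
    have h2 : (L u : ℕ) = (L v : ℕ) := by
      rw [abs_lt] at h1
      have a : ((L u : ℕ) : ℝ) < ((L v : ℕ) : ℝ) + 1 := by linarith
      have b : ((L v : ℕ) : ℝ) < ((L u : ℕ) : ℝ) + 1 := by linarith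
      have a' : (L u : ℕ) < (L v : ℕ) + 1 := by exact_mod_cast a
      have b' : (L v : ℕ) < (L u : ℕ) + 1 := by exact_mod_cast b
      omega
    exact huv.ne (L.injective (Fin.ext h2))
  have hdeg : ∀ v, degV H v = 0 := by
    intro v
    unfold degV
    have : IsEmpty (H.neighborSet v) := ⟨fun x => hno v x.1 x.2⟩
    exact Nat.card_of_isEmpty
  have hsq := sqrt_bd D k r hD hk hr ξ β hξ0 hβ0 hβ
  have hsqn : Real.sqrt β * n ≤ 1e-5 * (ξ * n) := by
    have := mul_le_mul_of_nonneg_right hsq hn0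
    linarith
  have hξm : ∀ i j, ξ * n ≤ 10 * m i j := by
    intro i j
    have h1 := mul_le_mul_of_nonneg_right hξ hn0
    have h2 := hmb i j
    have h3 : (n : ℝ) / (10 * k * r) = 1 / (k * r) * n / 10 := by
      field_simp
    linarith
  set P : Finset (Fin n) := Finset.univ.filter (fun v => ((L v : ℕ) : ℝ) + 1 ≤ Real.sqrt β * n)
    with hPdef
  have hPc : (P.card : ℝ) ≤ 2e-5 * (ξ * n) := by
    rcases P.eq_empty_or_nonempty with h | ⟨v, hv⟩
    · rw [h]; simp only [Finset.card_empty, Nat.cast_zero]; positivity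
    · have h0 : ((L v : ℕ) : ℝ) + 1 ≤ Real.sqrt β * n := (Finset.mem_filter.mp hv).2
      have h1 : (0 : ℝ) ≤ ((L v : ℕ) : ℝ) := Nat.cast_nonneg _
      have := label_le L 0 (Real.sqrt β * n) (by positivity) P (fun v hv =>
        ⟨by positivity, (Finset.mem_filter.mp hv).2⟩)
      linarith
  obtain ⟨f, hf1, hf2⟩ := exact_fill m hm P
    (fun v => ((⟨0, by omega⟩ : Fin r), finPr hk (σ v))) (by
      intro a
      have h1 := Finset.card_le_card (Finset.filter_subset
        (fun v => (((⟨0, by omega⟩ : Fin r), finPr hk (σ v)) : Fin r × Fin k) = a) P)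
      have h2 := hξm a.1 a.2
      have h3 : (P.card : ℝ) ≤ m a.1 a.2 := by linarith
      have h4 : P.card ≤ m a.1 a.2 := by exact_mod_cast h3
      exact h1.trans h4)
  refine ⟨f, ∅, ?_, by simpa using hξn, fun u v h => (hno u v h).elim,
    fun x _ y z h => (hno x y h).elim, ?_, ?_⟩
  · intro i j
    rw [hf2 i j]
    constructor <;> linarith
  · intro x hx
    rw [hf1 x (Finset.mem_filter.mpr ⟨Finset.mem_univ _, hx⟩)]
    refine ⟨rfl, ?_⟩
    have h0 := hpre x hx
    have h1 : (σ x : ℕ) ≠ 0 := fun h => h0 (Fin.ext h)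
    show (σ x : ℕ) - 1 + 1 = σ x
    omega
  · intro i j
    have h24 : (1 : ℝ) ≤ 24 * D := by linarith
    exact (div_le_self (Nat.cast_nonneg _) h24).trans (card_filt_le _ _
      (fun v hv => ⟨hv, by rw [hdeg]; exact Nat.zero_le _⟩))


lemma err_bounds (D k r : ℕ) (hD : 1 ≤ D) (hk : 1 ≤ k) (hr : 1 ≤ r) (N ε ξ w h : ℝ)
    (hξ0 : 0 < ξ) (hε : ε = ξ * N) (hε0 : 0 < ε) (hh : 1 ≤ h) (hw : w = 4 * k * h)
    (T1 l Q b0 : ℕ)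
    (n1 : (T1 : ℝ) * w ≤ 2e-5 * ε) (n2 : (k : ℝ) * r * (l * w) ≤ 1e-4 * ε)
    (n3 : (Q : ℝ) * w ≤ 5e-6 * ε) (n4 : (D : ℝ) * k * r * w ≤ 4e-10 * ε)
    (s : ℝ) (hs : s = 10 / ξ)
    (Δ G Zc Wc amax : ℝ) (hΔ : Δ = (T1 + l + 3) * w)
    (hG : G = (T1 + 3) * w + 1 + Q * (w + 1)) (hZc : Zc = 1 + N / w / s)
    (hWc : Wc = Zc * (w + 2 * h + 1)) (hamax : amax = (l + 3) * w + 1) :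
    4 ≤ w ∧ w ≤ 4e-10 * ε ∧ (l : ℝ) * w ≤ 1e-4 * ε ∧ 0 ≤ Δ ∧ Δ ≤ 13e-5 * ε ∧
    0 ≤ G ∧ 0 ≤ Wc ∧ 0 ≤ 2 * r * k * amax ∧
    2 + 2 * Δ + G + Wc + 2 * r * k * amax ≤ 0.2 * ε ∧ (Zc + Q) * (3 * w + 1) ≤ ε := by
  have hDR : (1 : ℝ) ≤ D := by exact_mod_cast hD
  have hkR : (1 : ℝ) ≤ k := by exact_mod_cast hk
  have hrR : (1 : ℝ) ≤ r := by exact_mod_cast hr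
  have hkr1 : (1 : ℝ) ≤ k * r := one_le_mul_of_one_le_of_one_le hkR hrR
  have hw0 : 0 < w := by rw [hw]; positivity
  have hhw : h ≤ w / 4 := by
    have : h ≤ k * h := le_mul_of_one_le_left (by linarith) hkR
    rw [hw]; linarith
  have hw4 : 4 ≤ w := by linarith
  have hT0 : (0 : ℝ) ≤ T1 := Nat.cast_nonneg _
  have hl0 : (0 : ℝ) ≤ l := Nat.cast_nonneg _
  have hQ0 : (0 : ℝ) ≤ Q := Nat.cast_nonneg _
  have hlw : 0 ≤ (l : ℝ) * w := by positivity
  have h1 : (l : ℝ) * w ≤ 1e-4 * ε := by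
    have : (l : ℝ) * w ≤ k * r * (l * w) := le_mul_of_one_le_left hlw hkr1
    linarith
  have h2 : (k : ℝ) * r * w ≤ 4e-10 * ε := by
    have : (k : ℝ) * r * w ≤ D * (k * r * w) := le_mul_of_one_le_left (by positivity) hDR
    linarith
  have h3 : w ≤ 4e-10 * ε := by
    have : w ≤ k * r * w := le_mul_of_one_le_left hw0.le hkr1
    linarith
  have hQQ : (Q : ℝ) ≤ Q * w / 4 := by
    have := mul_le_mul_of_nonneg_left hw4 hQ0
    linarith
  have hN0 : 0 < N := by
    by_contra hc
    have := mul_nonpos_of_nonneg_of_nonpos hξ0.le (not_lt.mp hc)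
    linarith
  have hZ0 : 0 ≤ Zc := by rw [hZc, hs]; positivity
  have hZw : Zc * w = w + ε / 10 := by
    rw [hZc, hs, hε]; field_simp
  have hZ4 : Zc ≤ Zc * w / 4 := by
    have := mul_le_mul_of_nonneg_left hw4 hZ0
    linarith
  have hZh : Zc * h ≤ Zc * w / 4 := by
    have := mul_le_mul_of_nonneg_left hhw hZ0
    linarith
  have hΔ0 : 0 ≤ Δ := by rw [hΔ]; positivity
  have hΔ1 : Δ = T1 * w + l * w + 3 * w := by rw [hΔ]; ring
  have hG1 : G = T1 * w + 3 * w + 1 + (Q * w + Q) := by rw [hG]; ring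
  have hW1 : Wc = Zc * w + 2 * (Zc * h) + Zc := by rw [hWc]; ring
  have ha : 2 * r * k * amax = 2 * (k * r * (l * w)) + 6 * (k * r * w) + 2 * (k * r) := by
    rw [hamax]; ring
  have hkr4 : (k : ℝ) * r ≤ k * r * w / 4 := by
    have := mul_le_mul_of_nonneg_left hw4 (by positivity : (0 : ℝ) ≤ k * r)
    linarith
  have hX : (Zc + Q) * (3 * w + 1) = 3 * (Zc * w) + 3 * (Q * w) + Zc + Q := by ring
  have hT1w : 0 ≤ (T1 : ℝ) * w := by positivity
  have hQw : 0 ≤ (Q : ℝ) * w := by positivity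
  have hZh0 : 0 ≤ Zc * h := by positivity
  have hkrw0 : 0 ≤ (k : ℝ) * r * w := by positivity
  have hkrl0 : 0 ≤ (k : ℝ) * r * (l * w) := by positivity
  refine ⟨hw4, h3, h1, hΔ0, ?_, ?_, ?_, ?_, ?_, ?_⟩
  · linarith
  · linarith
  · linarith
  · rw [ha]; linarith
  · rw [ha]; linarith
  · rw [hX]; linarith

lemma low_bd (D k r : ℕ) (hD : 1 ≤ D) (hk : 1 ≤ k) (hr : 1 ≤ r) (ε m M Δ ℓ b0 x y : ℝ)
    (hε0 : 0 < ε) (hε : ε ≤ 10 * m) (hℓ : 0 < ℓ) (h1 : 1 ≤ 1e-9 * ε) (hΔ0 : 0 ≤ Δ)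
    (hΔ : Δ ≤ 13e-5 * ε) (hkrl : (k : ℝ) * r * ℓ ≤ 1e-4 * ε)
    (hb0 : 0 ≤ b0) (hb : 0.99 * ℓ ≤ 6 * D * b0) (hM : k * (m - 1) ≤ M)
    (hx : x ≤ m + 0.2 * ε)
    (hy : b0 * ((M - Δ) / ℓ - 2) / k - 2 * r * k * b0 ≤ y) : x / (24 * D) ≤ y := by
  have hDR : (1 : ℝ) ≤ D := by exact_mod_cast hD
  have hkR : (1 : ℝ) ≤ k := by exact_mod_cast hk
  have hrR : (1 : ℝ) ≤ r := by exact_mod_cast hr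
  have hkr1 : (1 : ℝ) ≤ k * r := one_le_mul_of_one_le_of_one_le hkR hrR
  obtain ⟨Y, hY⟩ : ∃ Y : ℝ, Y = ((M - Δ) / ℓ - 2) / k - 2 * r * k := ⟨_, rfl⟩
  have hyY : b0 * Y ≤ y := by
    refine le_trans (le_of_eq ?_) hy
    rw [hY]; ring
  have hYl : Y * ℓ = (M - Δ - 2 * ℓ) / k - 2 * (k * r * ℓ) := by
    rw [hY]; field_simp
  have hlk : ℓ ≤ k * r * ℓ := le_mul_of_one_le_left hℓ.le hkr1
  have h2 : m - 1 - (Δ + 2 * ℓ) ≤ (M - Δ - 2 * ℓ) / k := by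
    rw [le_div_iff₀ (by linarith)]
    have : Δ + 2 * ℓ ≤ k * (Δ + 2 * ℓ) := le_mul_of_one_le_left (by linarith) hkR
    linarith
  have h3 : 0.99 * m ≤ Y * ℓ := by
    rw [hYl]; linarith
  have hY0 : 0 ≤ Y := by
    by_contra hc
    have := mul_nonpos_of_nonpos_of_nonneg (not_le.mp hc).le hℓ.le
    linarith
  have h4 := mul_le_mul_of_nonneg_left hb hY0
  have h5 : 3 * m ≤ 24 * (D * (b0 * Y)) := by linarith
  rw [div_le_iff₀ (by positivity)]
  have h6 := mul_le_mul_of_nonneg_left hyY (by positivity : (0 : ℝ) ≤ 24 * D)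
  linarith

/-- **Lemma for H** (Lemma 12 of "The bandwidth theorem in sparse graphs"). -/
theorem lemma_for_H (D k r : ℕ) (hD : 1 ≤ D) (hk : 1 ≤ k) (hr : 1 ≤ r) (ξ β : ℝ)
    (hξ0 : 0 < ξ) (hβ0 : 0 < β) (hξ : ξ ≤ 1 / (k * r))
    (hβ : β ≤ 1e-10 * ξ ^ 2 / ((D : ℝ) * k ^ 4 * r)) :
    ∀ n : ℕ, ∀ H : SimpleGraph (Fin n), DegeneracyLe H D →
    ∀ L : Equiv.Perm (Fin n),
      (∀ u v, H.Adj u v → |((L u : ℕ) : ℝ) - ((L v : ℕ) : ℝ)| ≤ β * n) →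
    ∀ σ : Fin n → Fin (k + 1),
      (∀ u v, H.Adj u v → σ u ≠ σ v) →
      ZeroFree (10 / ξ) β L σ →
      (∀ v, ((L v : ℕ) : ℝ) + 1 ≤ Real.sqrt β * n → σ v ≠ 0) →
    ∀ R : SimpleGraph (Fin r × Fin k), Bgraph r k ≤ R →
      (∀ i : Fin r, ∃ z : Fin r × Fin k, z.1 ≠ i ∧ ∀ j : Fin k, R.Adj z (i, j)) →
    ∀ m : Fin r → Fin k → ℕ,
      (∑ i, ∑ j, m i j) = n →
      (∀ i : Fin r, ∀ j j' : Fin k, (m i j : ℤ) - (m i j' : ℤ) ≤ 1) →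
      (∀ i j, (n : ℝ) / (10 * k * r) ≤ (m i j : ℝ) ∧ (m i j : ℝ) ≤ 10 * n / (k * r)) →
    ∃ (f : Fin n → Fin r × Fin k) (X : Finset (Fin n)),
      -- (H1)
      (∀ i j, (m i j : ℝ) - ξ * n
            ≤ ((Finset.univ.filter (fun v => f v = (i, j))).card : ℝ) ∧
          ((Finset.univ.filter (fun v => f v = (i, j))).card : ℝ) ≤ (m i j : ℝ) + ξ * n) ∧
      -- (H2)
      ((X.card : ℝ) ≤ ξ * n) ∧
      -- (H3)
      (∀ u v, H.Adj u v → R.Adj (f u) (f v)) ∧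
      -- (H4)
      (∀ x, x ∉ X → ∀ y z, H.Adj x y → H.Adj y z →
        (f y).1 = (f x).1 ∧ (f z).1 = (f x).1) ∧
      -- (H5)
      (∀ x, ((L x : ℕ) : ℝ) + 1 ≤ Real.sqrt β * n →
        ((f x).1 : ℕ) = 0 ∧ ((f x).2 : ℕ) + 1 = (σ x : ℕ)) ∧
      -- (H6)
      (∀ i j, ((Finset.univ.filter (fun v => f v = (i, j))).card : ℝ) / (24 * D)
          ≤ ((Finset.univ.filter
              (fun v => f v = (i, j) ∧ degV H v ≤ 2 * D)).card : ℝ)) := by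
  classical
  intro n H hH L hL σ hσ hzf hpre R hR hz m hm heq hmb
  by_cases hn : β * n < 1
  · exact small_case D k r hD hk hr ξ β hξ0 hβ0 hξ hβ n hn H L hL σ hpre R m hm
      (fun i j => (hmb i j).1)
  have hn1 : 1 ≤ β * n := not_lt.mp hn
  have hDR : (1 : ℝ) ≤ D := by exact_mod_cast hD
  have hkR : (1 : ℝ) ≤ k := by exact_mod_cast hk
  have hrR : (1 : ℝ) ≤ r := by exact_mod_cast hr
  have hkr1 : (1 : ℝ) ≤ k * r := one_le_mul_of_one_le_of_one_le hkR hrR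
  have hn0 : (0 : ℝ) < n := by
    by_contra hc
    have := mul_nonpos_of_nonneg_of_nonpos hβ0.le (not_lt.mp hc)
    linarith
  obtain ⟨w, hw⟩ : ∃ w : ℝ, w = 4 * k * (β * n) := ⟨_, rfl⟩
  obtain ⟨ε, hε⟩ : ∃ ε : ℝ, ε = ξ * n := ⟨_, rfl⟩
  have hε0 : 0 < ε := by rw [hε]; positivity
  obtain ⟨T1, l, Q, b0, a1, a2, a3, a4, a5, a6, a7, a8, a9, a10⟩ :=
    nums D k r hD hk hr ξ β n w hξ0 hβ0 hξ hβ hn1 hw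
  rw [← hε] at a6 a7 a8 a9
  obtain ⟨Δ, hΔ⟩ : ∃ Δ : ℝ, Δ = (T1 + l + 3) * w := ⟨_, rfl⟩
  obtain ⟨G, hG⟩ : ∃ G : ℝ, G = (T1 + 3) * w + 1 + Q * (w + 1) := ⟨_, rfl⟩
  obtain ⟨s, hs⟩ : ∃ s : ℝ, s = 10 / ξ := ⟨_, rfl⟩
  obtain ⟨Zc, hZc⟩ : ∃ Zc : ℝ, Zc = 1 + n / w / s := ⟨_, rfl⟩
  obtain ⟨Wc, hWc⟩ : ∃ Wc : ℝ, Wc = Zc * (w + 2 * (β * n) + 1) := ⟨_, rfl⟩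
  obtain ⟨amax, hamax⟩ : ∃ amax : ℝ, amax = (l + 3) * w + 1 := ⟨_, rfl⟩
  obtain ⟨c1, c2, c3, c4, c5, c6, c7, c8, c9, c10⟩ := err_bounds D k r hD hk hr n ε ξ w (β * n)
    hξ0 hε hε0 hn1 hw T1 l Q b0 a6 a7 a8 a9 s hs Δ G Zc Wc amax hΔ hG hZc hWc hamax
  have hξle : ξ ≤ 1 := hξ.trans (by rw [div_le_one (by linarith)]; exact hkr1)
  have hs10 : 10 ≤ s := by
    rw [hs, le_div_iff₀ hξ0]; linarith
  have hεm : ∀ i j, ε ≤ 10 * m i j := by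
    intro i j
    have h1 := mul_le_mul_of_nonneg_right hξ hn0.le
    have h2 := (hmb i j).1
    have h3 : (n : ℝ) / (10 * k * r) = 1 / (k * r) * n / 10 := by
      field_simp
    linarith
  -- the targets
  let Mi : ℕ → ℝ := fun x => if hx : x < r then ((∑ j, m ⟨x, hx⟩ j : ℕ) : ℝ) else 0
  have hMi : ∀ i : Fin r, Mi i = ∑ j, (m i j : ℝ) := by
    intro i
    simp only [Mi, i.2, dif_pos, Fin.eta]
    push_cast
    rfl
  let S : ℕ → ℝ := fun i => ∑ x ∈ Finset.range i, Mi x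
  have hSS : ∀ i : ℕ, S (i + 1) - S i = Mi i := by
    intro i
    simp only [S, Finset.sum_range_succ]
    ring
  have hM1 : ∀ (i : Fin r) (j : Fin k), k * ((m i j : ℝ) - 1) ≤ Mi i := by
    intro i j
    rw [hMi]
    have : ∑ _j' : Fin k, ((m i j : ℝ) - 1) ≤ ∑ j', (m i j' : ℝ) := by
      refine Finset.sum_le_sum fun j' _ => ?_
      have := heq i j j'
      have h2 : (m i j : ℝ) - (m i j' : ℝ) ≤ 1 := by exact_mod_cast this
      linarith
    rwa [Finset.sum_const, Finset.card_univ, Fintype.card_fin, nsmul_eq_mul] at this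
  have hM2 : ∀ (i : Fin r) (j : Fin k), Mi i ≤ k * ((m i j : ℝ) + 1) := by
    intro i j
    rw [hMi]
    have : ∑ j', (m i j' : ℝ) ≤ ∑ _j' : Fin k, ((m i j : ℝ) + 1) := by
      refine Finset.sum_le_sum fun j' _ => ?_
      have := heq i j' j
      have h2 : (m i j' : ℝ) - (m i j : ℝ) ≤ 1 := by exact_mod_cast this
      linarith
    rwa [Finset.sum_const, Finset.card_univ, Fintype.card_fin, nsmul_eq_mul] at this
  have hM3 : ∀ i : Fin r, ε / 10 ≤ Mi i := by
    intro i
    have h0 : ε / 10 ≤ m i ⟨0, by omega⟩ := by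
      have := hεm i ⟨0, by omega⟩
      linarith
    refine h0.trans ?_
    rw [hMi]
    exact Finset.single_le_sum (f := fun j => (m i j : ℝ)) (fun j _ => Nat.cast_nonneg _)
      (Finset.mem_univ _)
  have hSr : S r = n := by
    have h1 : S r = ∑ i : Fin r, Mi i := (Fin.sum_univ_eq_sum_range Mi r).symm
    rw [h1, ← hm]
    push_cast
    exact Finset.sum_congr rfl fun i _ => hMi i
  have hSl : ∀ i, i < r → S i + l * w ≤ S (i + 1) := by
    intro i hi
    have h1 := hSS i
    have h2 := hM3 ⟨i, hi⟩
    simp only at h2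
    linarith
  have hwb : 4 * (k : ℝ) * β * n = w := by rw [hw]; ring
  obtain ⟨f, X, e1, e2, e3, e4, e5⟩ := construct D k r n hD hk hr (β * n) w hn1 hw H hH L hL σ hσ s
    hs10 (by
      intro a b hab ha hb
      have := hzf (a + 1) (b + 1) (by omega) (by omega)
        (by
          obtain ⟨v, v1, v2, v3⟩ := ha
          refine ⟨v, v1, ?_, ?_⟩
          · rw [hwb]; push_cast; rw [add_sub_cancel_right]; exact v2
          · rw [hwb]; push_cast; exact v3)
        (by
          obtain ⟨v, v1, v2, v3⟩ := hb
          refine ⟨v, v1, ?_, ?_⟩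
          · rw [hwb]; push_cast; rw [add_sub_cancel_right]; exact v2
          · rw [hwb]; push_cast; exact v3)
      rw [← hs] at this
      push_cast at this
      linarith)
    (Real.sqrt β * n) hpre R hR hz T1 l Q b0 a1 a2 a3 S rfl hSr hSl a4 a5 Δ G Zc Wc amax
    hΔ hG hZc hWc hamax
  have hcard : ∀ i j, (m i j : ℝ) - 0.2 * ε
        ≤ ((Finset.univ.filter (fun v => f v = (i, j))).card : ℝ) ∧
      ((Finset.univ.filter (fun v => f v = (i, j))).card : ℝ) ≤ (m i j : ℝ) + 0.2 * ε := by
    intro i j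
    obtain ⟨g1, g2, -⟩ := e1 i j
    have hMM := hSS i
    constructor
    · refine le_trans ?_ (g1.trans (card_filt_le _ _ (fun v hv => hv)))
      have : (m i j : ℝ) - 1 - (2 * Δ + 1 + G + Wc) ≤ (S (i + 1) - S i - 2 * Δ - 1 - G - Wc) / k := by
        rw [le_div_iff₀ (by linarith), hMM]
        have h1 := hM1 i j
        have h2 : 2 * Δ + 1 + G + Wc ≤ k * (2 * Δ + 1 + G + Wc) :=
          le_mul_of_one_le_left (by linarith) hkR
        linarith
      linarith
    · refine le_trans ((card_filt_le _ _ (fun v hv => hv)).trans g2) ?_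
      have : (S (i + 1) - S i + 2 * Δ + 1) / k ≤ (m i j : ℝ) + 1 + (2 * Δ + 1) := by
        rw [div_le_iff₀ (by linarith), hMM]
        have h1 := hM2 i j
        have h2 : 2 * Δ + 1 ≤ k * (2 * Δ + 1) :=
          le_mul_of_one_le_left (by linarith) hkR
        linarith
      linarith
  refine ⟨f, X, ?_, ?_, e3, e4, e5, ?_⟩
  · intro i j
    rw [← hε]
    obtain ⟨g1, g2⟩ := hcard i j
    constructor <;> linarith
  · rw [← hε]; exact e2.trans c10
  · intro i j
    have hl5 : (5 : ℝ) ≤ l := by exact_mod_cast a2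
    obtain ⟨-, -, g3⟩ := e1 i j
    have hMM := hSS i
    have hE : S (i + 1) - Δ - S i = Mi i - Δ := by linarith
    rw [hE] at g3
    exact low_bd D k r hD hk hr ε (m i j) (Mi i) Δ (l * w) b0 _ _ hε0 (hεm i j) (by positivity)
      (by linarith) c4 c5 a7 (Nat.cast_nonneg _) a10 (hM1 i j) (hcard i j).2
      (g3.trans (card_filt_le _ _ (fun v hv => hv)))
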